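/- arXiv:2203.16904 — 7 statements merged into one kernel-verified Lean document; each statement's English description precedes it below -/
import Mathlib

section
/- In the noncritical case, the variance of the unbiased Lotka–Nagaev-type estimator of the structural parameter of the Markov Q-process, which equals V(t) := (1−β)·Σ_{k≥1} ((k+1) q^k P_{1,k+1}(t)/β^t)·(γ + k(1+γ)β)/k², is bounded: V(t) = O(1) as t → ∞. -/
open scoped Topology

lemma pow_tangent (k : ℕ) (x y : ℝ) (hx : 0 ≤ x) (hy : 0 ≤ y) :
    y ^ k + (k : ℝ) * y ^ (k - 1) * (x - y) ≤ x ^ k := by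
  induction k with
  | zero => simp
  | succ n ih =>
    have h1 : ((n : ℝ)) * y ^ (n - 1) * y = n * y ^ n := by
      cases n with
      | zero => simp
      | succ m => simp [pow_succ]; ring
    have h2 := mul_le_mul_of_nonneg_right ih hx
    have h3 : 0 ≤ (n : ℝ) * y ^ (n - 1) * (x - y) ^ 2 := by positivity
    have h4 : (n : ℝ) * y ^ (n - 1) * (x - y) * x
        = (n : ℝ) * y ^ (n - 1) * (x - y) ^ 2 + (n * y ^ (n-1) * y) * (x - y) := by ring
    push_cast
    simp only [pow_succ]
    rw [h1] at h4
    nlinarith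

lemma pow_lip (k : ℕ) (x y : ℝ) (hx : x ∈ Set.Icc (0:ℝ) 1) (hy : y ∈ Set.Icc (0:ℝ) 1) :
    |x ^ k - y ^ k| ≤ k * |x - y| := by
  induction k with
  | zero => simp
  | succ n ih =>
    have : x ^ (n+1) - y ^ (n+1) = x ^ n * (x - y) + (x ^ n - y ^ n) * y := by ring
    rw [this]
    refine (abs_add_le _ _).trans ?_
    rw [abs_mul, abs_mul, abs_of_nonneg hy.1, abs_of_nonneg (pow_nonneg hx.1 n)]
    have h1 : x ^ n * |x - y| ≤ 1 * |x - y| :=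
      mul_le_mul_of_nonneg_right (pow_le_one₀ hx.1 hx.2) (abs_nonneg _)
    have h2 : |x ^ n - y ^ n| * y ≤ |x ^ n - y ^ n| * 1 :=
      mul_le_mul_of_nonneg_left hy.2 (abs_nonneg _)
    push_cast
    linarith

theorem stmt_1
    (a : ℕ → ℝ) (f : ℝ → ℝ) (P : ℝ → ℕ → ℝ) (Φ : ℝ → ℝ → ℝ)
    (ha : ∀ k : ℕ, k ≠ 1 → 0 ≤ a k)
    (ha0 : 0 < a 0)
    (ha1 : HasSum (fun k : ℕ => if k = 1 then (0:ℝ) else a k) (-(a 1)))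
    (ha01 : a 0 < -(a 1))
    (hf : ∀ x ∈ Set.Icc (0:ℝ) 1, HasSum (fun k : ℕ => a k * x ^ k) (f x))
    (hPnn : ∀ t : ℝ, 0 ≤ t → ∀ j : ℕ, 0 ≤ P t j)
    (hPsum : ∀ t : ℝ, 0 ≤ t → HasSum (fun j : ℕ => P t j) 1)
    (hΦ : ∀ t : ℝ, 0 ≤ t → ∀ x ∈ Set.Icc (0:ℝ) 1, HasSum (fun j : ℕ => P t j * x ^ j) (Φ t x))
    (hΦ0 : ∀ x ∈ Set.Icc (0:ℝ) 1, Φ 0 x = x)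
    (hKol : ∀ x ∈ Set.Icc (0:ℝ) 1, ∀ t : ℝ, 0 ≤ t → HasDerivAt (fun s => Φ s x) (f (Φ t x)) t)
    (m : ℝ)
    (hm : HasSum (fun k : ℕ => (k : ℝ) * a k) m)
    (hnoncrit : m ≠ 0)
    (q fq β : ℝ)
    (hq : q = sInf {x : ℝ | x ∈ Set.Icc (0:ℝ) 1 ∧ f x = 0})
    (hfq : HasSum (fun k : ℕ => (k : ℝ) * a k * q ^ (k - 1)) fq)
    (hβ : β = Real.exp fq)
    (hβlt : β < 1)
    (b : ℝ)
    (hb : HasSum (fun k : ℕ => (k : ℝ) * ((k : ℝ) - 1) * a k * q ^ (k - 1)) b)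
    :
    (fun t : ℝ => (1 - β) * ∑' k : ℕ,
        ((k : ℝ) + 2) * q ^ (k + 1) * P t (k + 2) / β ^ t
          * (b / |Real.log β| + ((k : ℝ) + 1) * (1 + b / |Real.log β|) * β) / ((k : ℝ) + 1) ^ 2)
      =O[Filter.atTop] fun _ : ℝ => (1 : ℝ) := by
  have hlip : ∀ x ∈ Set.Icc (0:ℝ) 1, ∀ y ∈ Set.Icc (0:ℝ) 1,
      |f x - f y| ≤ (∑' k : ℕ, |(k:ℝ) * a k|) * |x - y| := by
    intro x hx y hy
    have hs := hm.summable.abs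
    have h := (hf x hx).sub (hf y hy)
    have h2 : ∀ k : ℕ, |a k * x ^ k - a k * y ^ k| ≤ |(k:ℝ) * a k| * |x - y| := by
      intro k
      rw [← mul_sub, abs_mul, abs_mul, Nat.abs_cast]
      nlinarith [mul_le_mul_of_nonneg_left (pow_lip k x y hx hy) (abs_nonneg (a k))]
    have h3 : Summable fun k : ℕ => |(k:ℝ) * a k| * |x - y| := hs.mul_right _
    have h4 := tsum_of_norm_bounded h3.hasSum (f := fun k => a k * x ^ k - a k * y ^ k) h2
    rw [h.tsum_eq, tsum_mul_right] at h4
    exact h4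
  set L := ∑' k : ℕ, |(k:ℝ) * a k| with hL
  have hL0 : 0 ≤ L := tsum_nonneg fun _ => abs_nonneg _
  have hLW : LipschitzOnWith (Real.toNNReal L) f (Set.Icc 0 1) := by
    refine LipschitzOnWith.of_dist_le_mul fun x hx y hy => ?_
    rw [Real.dist_eq, Real.dist_eq, Real.coe_toNNReal _ hL0]
    exact hlip x hx y hy
  have hcont := hLW.continuousOn
  have hf1 : f 1 = 0 := by
    have h := (hf 1 (by simp)).unique (by
      have := ha1.add (hasSum_ite_eq (1:ℕ) (a 1))
      refine (this.congr_fun ?_ : HasSum (fun k : ℕ => a k * 1 ^ k) _)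
      intro k
      by_cases hk : k = 1 <;> simp [hk])
    simpa using h
  have hqmem : q ∈ {x : ℝ | x ∈ Set.Icc (0:ℝ) 1 ∧ f x = 0} := by
    rw [hq]
    refine IsClosed.csInf_mem ?_ ⟨1, by simp, hf1⟩ ⟨0, fun x hx => hx.1.1⟩
    exact hcont.preimage_isClosed_of_isClosed isClosed_Icc isClosed_singleton
  obtain ⟨hqI, hfq0⟩ := hqmem
  have hf0 : f 0 = a 0 := by
    refine (hf 0 (by simp)).unique ?_
    convert hasSum_single (f := fun k : ℕ => a k * (0:ℝ) ^ k) 0 ?_ using 1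
    · simp
    · intro k hk; simp [hk]
  have hqpos : 0 < q := by
    rcases hqI.1.lt_or_eq with h | h
    · exact h
    · rw [← h, hf0] at hfq0; linarith
  have htan : ∀ x ∈ Set.Icc (0:ℝ) 1, fq * (x - q) ≤ f x := by
    intro x hx
    have h := ((hf q hqI).add (hfq.mul_right (x - q)))
    have := hasSum_le (fun k => ?_) h (hf x hx)
    · rw [hfq0] at this; linarith
    · by_cases hk : k = 1
      · subst hk; simp; linarith
      · have := mul_le_mul_of_nonneg_left (pow_tangent k x q hx.1 hqI.1) (ha k hk)
        linarith
  have hΦmem : ∀ t, 0 ≤ t → ∀ x ∈ Set.Icc (0:ℝ) 1, Φ t x ∈ Set.Icc (0:ℝ) 1 := by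
    intro t ht x hx
    constructor
    · exact (hΦ t ht x hx).nonneg fun j => mul_nonneg (hPnn t ht j) (pow_nonneg hx.1 j)
    · exact hasSum_le (fun j => mul_le_of_le_one_right (hPnn t ht j) (pow_le_one₀ hx.1 hx.2))
        (hΦ t ht x hx) (hPsum t ht)
  have hΦq : ∀ t, 0 ≤ t → Φ t q = q := by
    intro t ht
    have := ODE_solution_unique_of_mem_Icc_right (v := fun _ => f) (s := fun _ => Set.Icc (0:ℝ) 1)
      (K := Real.toNNReal L) (f := fun s => Φ s q) (g := fun _ => q) (a := 0) (b := t)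
      (fun _ _ => hLW)
      (fun s hs => (hKol q hqI s hs.1).continuousAt.continuousWithinAt)
      (fun s hs => (hKol q hqI s hs.1).hasDerivWithinAt)
      (fun s hs => hΦmem s hs.1 q hqI)
      continuousOn_const
      (fun s hs => by rw [hfq0]; exact hasDerivWithinAt_const _ _ _)
      (fun s hs => hqI)
      (hΦ0 q hqI)
    exact this ⟨ht, le_rfl⟩
  have h0I : (0:ℝ) ∈ Set.Icc (0:ℝ) 1 := by simp
  have hR : ∀ t, 0 ≤ t → q - Φ t 0 ≤ q * Real.exp (fq * t) := by
    intro t ht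
    have hd : ∀ s, 0 ≤ s → HasDerivAt (fun s => (q - Φ s 0) * Real.exp (-(fq * s)))
        ((-f (Φ s 0)) * Real.exp (-(fq * s))
          + (q - Φ s 0) * (Real.exp (-(fq * s)) * (-(fq * 1)))) s := by
      intro s hs
      exact ((hKol 0 h0I s hs).const_sub q).mul (((hasDerivAt_id s).const_mul fq).neg.exp)
    have hanti : AntitoneOn (fun s => (q - Φ s 0) * Real.exp (-(fq * s))) (Set.Ici 0) := by
      refine antitoneOn_of_deriv_nonpos (convex_Ici 0)
        (fun s hs => (hd s hs).continuousAt.continuousWithinAt) ?_ ?_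
      · intro s hs
        rw [interior_Ici] at hs
        exact (hd s (le_of_lt hs)).differentiableAt.differentiableWithinAt
      · intro s hs
        rw [interior_Ici] at hs
        rw [(hd s (le_of_lt hs)).deriv]
        have := htan _ (hΦmem s (le_of_lt hs) 0 h0I)
        have he := Real.exp_pos (-(fq * s))
        nlinarith
    have h := hanti (Set.mem_Ici.2 le_rfl) (Set.mem_Ici.2 ht) ht
    simp only [hΦ0 0 h0I, mul_zero, neg_zero, Real.exp_zero, sub_zero, mul_one] at h
    rw [Real.exp_neg] at h
    have he := Real.exp_pos (fq * t)
    rwa [← div_eq_mul_inv, div_le_iff₀ he] at h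
  have hb0 : 0 ≤ b := by
    refine hb.nonneg fun k => ?_
    by_cases hk : k = 1
    · simp [hk]
    · rcases Nat.eq_zero_or_pos k with h | h
      · simp [h]
      · have : (1:ℝ) ≤ k := by exact_mod_cast h
        exact mul_nonneg (mul_nonneg (mul_nonneg (by linarith) (by linarith)) (ha k hk))
          (pow_nonneg hqI.1 _)
  have hβ0 : 0 < β := hβ ▸ Real.exp_pos _
  have hg0 : 0 ≤ b / |Real.log β| := by positivity
  set g := b / |Real.log β| with hg
  clear_value g
  set C := g + (1 + g) * β with hC
  have hC0 : 0 ≤ C := by positivity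
  rw [Asymptotics.isBigO_iff]
  refine ⟨(1 - β) * (2 * C), ?_⟩
  filter_upwards [Filter.eventually_ge_atTop (0:ℝ)] with t ht
  have hβt : β ^ t = Real.exp (fq * t) := by rw [hβ, ← Real.exp_mul]
  have hβt0 : 0 < β ^ t := Real.rpow_pos_of_pos hβ0 t
  have hterm0 : ∀ k : ℕ, 0 ≤ ((k : ℝ) + 2) * q ^ (k + 1) * P t (k + 2) / β ^ t
          * (g + ((k : ℝ) + 1) * (1 + g) * β) / ((k : ℝ) + 1) ^ 2 := by
    intro k
    have := hPnn t ht (k+2)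
    positivity
  have hterm : ∀ k : ℕ, ((k : ℝ) + 2) * q ^ (k + 1) * P t (k + 2) / β ^ t
          * (g + ((k : ℝ) + 1) * (1 + g) * β) / ((k : ℝ) + 1) ^ 2
        ≤ (2 * C / (q * β ^ t)) * (P t (k + 2) * q ^ (k + 2)) := by
    intro k
    have hp := hPnn t ht (k+2)
    have hk : (0:ℝ) ≤ k := Nat.cast_nonneg k
    have e1 : ((k : ℝ) + 2) * q ^ (k + 1) * P t (k + 2) / β ^ t
          * (g + ((k : ℝ) + 1) * (1 + g) * β) / ((k : ℝ) + 1) ^ 2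
        = (q ^ (k + 1) * P t (k + 2) / β ^ t) *
          (((k : ℝ) + 2) * (g + ((k : ℝ) + 1) * (1 + g) * β) / ((k : ℝ) + 1) ^ 2) := by ring
    have e2 : (2 * C / (q * β ^ t)) * (P t (k + 2) * q ^ (k + 2))
        = (q ^ (k + 1) * P t (k + 2) / β ^ t) * (2 * C) := by
      field_simp
      ring
    rw [e1, e2]
    refine mul_le_mul_of_nonneg_left ?_ (by positivity)
    rw [div_le_iff₀ (by positivity)]
    have i1 : g + ((k : ℝ) + 1) * (1 + g) * β ≤ C * (k + 1) := by
      rw [hC]; nlinarith [mul_nonneg hg0 hk]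
    have i2 : (k : ℝ) + 2 ≤ 2 * (k + 1) := by linarith
    calc ((k : ℝ) + 2) * (g + ((k : ℝ) + 1) * (1 + g) * β)
        ≤ (2 * (k + 1)) * (C * (k + 1)) := mul_le_mul i2 i1 (by positivity) (by positivity)
      _ = 2 * C * ((k : ℝ) + 1) ^ 2 := by ring
  have hP0 : Φ t 0 = P t 0 := by
    refine (hΦ t ht 0 h0I).unique ?_
    convert hasSum_single (f := fun k : ℕ => P t k * (0:ℝ) ^ k) 0 ?_ using 1
    · simp
    · intro k hk; simp [hk]
  have hsh := (hasSum_nat_add_iff' 2).2 (hΦ t ht q hqI)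
  have hsumle := Summable.tsum_le_tsum hterm
    (Summable.of_nonneg_of_le hterm0 hterm (hsh.mul_left _).summable) (hsh.mul_left _).summable
  rw [(hsh.mul_left _).tsum_eq, hΦq t ht] at hsumle
  have hfin : (2 * C / (q * β ^ t)) * (q - ∑ i ∈ Finset.range 2, P t i * q ^ i) ≤ 2 * C := by
    have h1 : q - ∑ i ∈ Finset.range 2, P t i * q ^ i ≤ q * β ^ t := by
      have h2 := hR t ht
      have h3 : 0 ≤ P t 1 * q := mul_nonneg (hPnn t ht 1) hqI.1
      rw [hP0] at h2
      rw [hβt]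
      simp only [Finset.sum_range_succ, Finset.sum_range_zero, pow_zero, pow_one]
      linarith
    calc _ ≤ (2 * C / (q * β ^ t)) * (q * β ^ t) := mul_le_mul_of_nonneg_left h1 (by positivity)
      _ = 2 * C := by field_simp
  have h1β : 0 ≤ 1 - β := by linarith
  rw [Real.norm_of_nonneg (mul_nonneg h1β (tsum_nonneg hterm0)), norm_one, mul_one]
  exact mul_le_mul_of_nonneg_left (hsumle.trans hfin) h1β
end

section
/- In the critical case, t²·P_{11}(t) → 2/(b·a_0) as t → ∞; equivalently, the Q-process return probability Q_{11}(t) = P_{11}(t) satisfies t²·Q_{11}(t) → 2/(b·a_0). -/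
open scoped Topology

lemma aux_r_lower (u : ℝ) (hu0 : 0 ≤ u) (hu1 : u ≤ 1) (k : ℕ) :
    u ^ 2 ≤ (1 - u) ^ (k + 2) - 1 + ((k + 2 : ℕ) : ℝ) * u := by
  induction k with
  | zero => norm_num; nlinarith
  | succ n ih =>
    have h1 : (1 - u) ^ (n + 2) ≤ 1 := pow_le_one₀ (by linarith) (by linarith)
    have h2 : (1 - u) ^ (n + 1 + 2) = (1 - u) ^ (n + 2) * (1 - u) := by ring
    rw [h2]
    push_cast at ih ⊢
    nlinarith

lemma aux_r_upper (u : ℝ) (hu0 : 0 ≤ u) (hu1 : u ≤ 1) (k : ℕ) :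
    0 ≤ (1 - u) ^ k - 1 + (k : ℝ) * u ∧
    (1 - u) ^ k - 1 + (k : ℝ) * u ≤ (k : ℝ) * ((k : ℝ) - 1) / 2 * u ^ 2 := by
  induction k with
  | zero => norm_num
  | succ n ih =>
    have h1 : (1 - u) ^ n ≤ 1 := pow_le_one₀ (by linarith) (by linarith)
    have h2 : (1 - u) ^ (n + 1) = (1 - u) ^ n * (1 - u) := by ring
    rw [h2]
    obtain ⟨i1, i2⟩ := ih
    push_cast
    constructor <;> nlinarith

lemma aux_r_lim (k : ℕ) :
    Filter.Tendsto (fun u : ℝ => ((1 - u) ^ k - 1 + (k : ℝ) * u) / u ^ 2) (𝓝[>] 0)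
      (𝓝 ((k : ℝ) * ((k : ℝ) - 1) / 2)) := by
  induction k with
  | zero => simp
  | succ n ih =>
    have hd : HasDerivAt (fun u : ℝ => (1 - u) ^ n) (-(n : ℝ)) 0 := by
      have h := ((hasDerivAt_id (0 : ℝ)).const_sub 1).pow n
      have e : (n : ℝ) * (1 - id (0 : ℝ)) ^ (n - 1) * -1 = -(n : ℝ) := by simp
      rw [e] at h
      exact h
    have hs := hd.tendsto_slope_zero_right
    have h3 := ih.sub hs
    have : (((n + 1 : ℕ) : ℝ) * (((n + 1 : ℕ) : ℝ) - 1) / 2) = (n : ℝ) * ((n : ℝ) - 1) / 2 - -(n : ℝ) := by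
      push_cast; ring
    rw [this]
    refine h3.congr' ?_
    filter_upwards [self_mem_nhdsWithin] with u hu
    have hu : (0 : ℝ) < u := hu
    simp only [zero_add, sub_zero, one_pow, smul_eq_mul]
    push_cast
    field_simp
    ring

/-- Averaging: derivative converging implies linear growth rate. -/
lemma aux_avg (H H' : ℝ → ℝ) (c : ℝ) (hH : ∀ t, 0 ≤ t → HasDerivAt H (H' t) t)
    (hl : Filter.Tendsto H' Filter.atTop (𝓝 c)) :
    Filter.Tendsto (fun t => H t / t) Filter.atTop (𝓝 c) := by
  rw [Metric.tendsto_atTop] at hl ⊢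
  intro ε hε
  obtain ⟨T0, hT0⟩ := hl (ε / 2) (by linarith)
  set T := max T0 0 with hT
  have hTnn : 0 ≤ T := le_max_right _ _
  have key : ∀ t, T ≤ t → |H t - c * t - (H T - c * T)| ≤ ε / 2 * (t - T) := by
    intro t ht
    have := Convex.norm_image_sub_le_of_norm_hasDerivWithin_le (f := fun t => H t - c * t)
      (f' := fun t => H' t - c) (C := ε / 2) (s := Set.Icc T t) (x := T) (y := t)
      (fun x hx => by
        have h := (hH x (hTnn.trans hx.1)).sub ((hasDerivAt_id x).const_mul c)
        simp only [id, mul_one] at h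
        exact h.hasDerivWithinAt)
      (fun x hx => by
        have := hT0 x ((le_max_left _ _).trans hx.1)
        rw [Real.dist_eq] at this
        exact this.le) (convex_Icc _ _) ⟨le_rfl, ht⟩ ⟨ht, le_rfl⟩
    simpa [Real.norm_eq_abs, abs_of_nonneg (sub_nonneg.2 ht)] using this
  set M := |H T - c * T| with hM
  refine ⟨max (T + 1) (2 * M / ε + 1), fun t ht => ?_⟩
  have h1 : T + 1 ≤ t := (le_max_left _ _).trans ht
  have h2 : 2 * M / ε + 1 ≤ t := (le_max_right _ _).trans ht
  have htp : 0 < t := by linarith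
  have h3 : 2 * M / ε < t := by linarith
  rw [div_lt_iff₀ hε] at h3
  have hk := key t (by linarith)
  rw [Real.dist_eq]
  have : H t / t - c = (H t - c * t) / t := by field_simp
  rw [this, abs_div, abs_of_pos htp, div_lt_iff₀ htp]
  have h4 : |H t - c * t| ≤ |H t - c * t - (H T - c * T)| + M := by
    have := abs_add_le (H t - c * t - (H T - c * T)) (H T - c * T)
    simpa using this
  nlinarith

theorem stmt_2
    (a : ℕ → ℝ) (f : ℝ → ℝ) (P : ℝ → ℕ → ℝ) (Φ : ℝ → ℝ → ℝ)
    (ha : ∀ k : ℕ, k ≠ 1 → 0 ≤ a k)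
    (ha0 : 0 < a 0)
    (ha1 : HasSum (fun k : ℕ => if k = 1 then (0:ℝ) else a k) (-(a 1)))
    (ha01 : a 0 < -(a 1))
    (hf : ∀ x ∈ Set.Icc (0:ℝ) 1, HasSum (fun k : ℕ => a k * x ^ k) (f x))
    (hPnn : ∀ t : ℝ, 0 ≤ t → ∀ j : ℕ, 0 ≤ P t j)
    (hPsum : ∀ t : ℝ, 0 ≤ t → HasSum (fun j : ℕ => P t j) 1)
    (hΦ : ∀ t : ℝ, 0 ≤ t → ∀ x ∈ Set.Icc (0:ℝ) 1, HasSum (fun j : ℕ => P t j * x ^ j) (Φ t x))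
    (hΦ0 : ∀ x ∈ Set.Icc (0:ℝ) 1, Φ 0 x = x)
    (hKol : ∀ x ∈ Set.Icc (0:ℝ) 1, ∀ t : ℝ, 0 ≤ t → HasDerivAt (fun s => Φ s x) (f (Φ t x)) t)
    (b : ℝ)
    (hcrit : HasSum (fun k : ℕ => (k : ℝ) * a k) 0)
    (hb : HasSum (fun k : ℕ => (k : ℝ) * ((k : ℝ) - 1) * a k) b)
    :
    Filter.Tendsto (fun t : ℝ => t ^ 2 * P t 1) Filter.atTop (𝓝 (2 / (b * a 0))) := by
  have h0mem : (0:ℝ) ∈ Set.Icc (0:ℝ) 1 := by simp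
  -- sum of a is zero
  have hsum0 : HasSum a 0 := by
    have h := ha1.add (hasSum_ite_eq 1 (a 1))
    rw [neg_add_cancel] at h
    refine h.congr_fun ?_ |> fun h => h
    intro k
    by_cases hk : k = 1 <;> simp [hk]
  have hfr : ∀ u ∈ Set.Icc (0:ℝ) 1,
      HasSum (fun k : ℕ => a k * ((1 - u) ^ k - 1 + (k : ℝ) * u)) (f (1 - u)) := by
    intro u hu
    have h := ((hf (1 - u) ⟨by linarith [hu.2], by linarith [hu.1]⟩).sub hsum0).add
      (hcrit.mul_right u)
    simp only [sub_zero, zero_mul, add_zero] at h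
    refine h.congr_fun ?_ |> fun h => h
    intro k
    ring
  have hrnn : ∀ k : ℕ, ∀ u ∈ Set.Icc (0:ℝ) 1, 0 ≤ a k * ((1 - u) ^ k - 1 + (k : ℝ) * u) := by
    intro k u hu
    by_cases hk : k = 1
    · subst hk; simp
    · exact mul_nonneg (ha k hk) (aux_r_upper u hu.1 hu.2 k).1
  have hrub : ∀ k : ℕ, ∀ u ∈ Set.Icc (0:ℝ) 1, a k * ((1 - u) ^ k - 1 + (k : ℝ) * u) ≤
      ((k : ℝ) * ((k : ℝ) - 1) * a k) * (u ^ 2 / 2) := by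
    intro k u hu
    by_cases hk : k = 1
    · subst hk; simp
    · have := mul_le_mul_of_nonneg_left (aux_r_upper u hu.1 hu.2 k).2 (ha k hk)
      linarith
  have hfub : ∀ u ∈ Set.Icc (0:ℝ) 1, f (1 - u) ≤ b / 2 * u ^ 2 := by
    intro u hu
    have := hasSum_le (fun k => hrub k u hu) (hfr u hu) (hb.mul_right (u ^ 2 / 2))
    linarith
  -- positivity of some coefficient
  obtain ⟨m, hm⟩ : ∃ m : ℕ, 0 < a (m + 2) := by
    by_contra hcon
    push Not at hcon
    have hz : ∀ k : ℕ, k ∉ ({0, 1} : Finset ℕ) → a k = 0 := by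
      intro k hk
      simp at hk
      obtain ⟨j, rfl⟩ : ∃ j, k = j + 2 := ⟨k - 2, by omega⟩
      exact le_antisymm (hcon j) (ha _ hk.2)
    have h := hsum0.unique (hasSum_sum_of_ne_finset_zero hz)
    simp at h
    linarith
  have hflb : ∀ u ∈ Set.Icc (0:ℝ) 1, a (m + 2) * u ^ 2 ≤ f (1 - u) := by
    intro u hu
    have h1 := le_hasSum (hfr u hu) (m + 2) (fun k _ => hrnn k u hu)
    exact (mul_le_mul_of_nonneg_left (aux_r_lower u hu.1 hu.2 m) hm.le).trans h1
  have hbpos : 0 < b := by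
    have h1 := hflb 1 (by simp)
    have h2 := hfub 1 (by simp)
    have h3 := h1.trans h2
    norm_num at h3
    linarith
  have hglim : Filter.Tendsto (fun u : ℝ => f (1 - u) / u ^ 2) (𝓝[>] 0) (𝓝 (b / 2)) := by
    have ht := tendsto_tsum_of_dominated_convergence (𝓕 := 𝓝[>] (0:ℝ))
      (f := fun u k => a k * ((1 - u) ^ k - 1 + (k : ℝ) * u) / u ^ 2)
      (g := fun k : ℕ => ((k : ℝ) * ((k : ℝ) - 1) * a k) * (1 / 2))
      (bound := fun k : ℕ => ((k : ℝ) * ((k : ℝ) - 1) * a k) * (1 / 2))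
      (hb.mul_right (1 / 2)).summable
      (fun k => by
        have h := (aux_r_lim k).const_mul (a k)
        have e : ((k : ℝ) * ((k : ℝ) - 1) * a k) * (1 / 2) = a k * ((k : ℝ) * ((k : ℝ) - 1) / 2) := by
          ring
        rw [e]
        refine h.congr fun u => ?_
        ring)
      (by
        have : Set.Ioo (0:ℝ) 1 ∈ 𝓝[>] (0:ℝ) := Ioo_mem_nhdsGT one_pos
        filter_upwards [this] with u hu k
        have hu' : u ∈ Set.Icc (0:ℝ) 1 := ⟨hu.1.le, hu.2.le⟩
        have hu2 : 0 < u ^ 2 := pow_pos hu.1 2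
        rw [Real.norm_eq_abs, abs_of_nonneg (div_nonneg (hrnn k u hu') hu2.le), div_le_iff₀ hu2]
        have := hrub k u hu'
        linarith)
    rw [(hb.mul_right (1 / 2)).tsum_eq] at ht
    have e : b / 2 = b * (1 / 2) := by ring
    rw [e]
    refine ht.congr' ?_
    have : Set.Ioo (0:ℝ) 1 ∈ 𝓝[>] (0:ℝ) := Ioo_mem_nhdsGT one_pos
    filter_upwards [this] with u hu
    exact ((hfr u ⟨hu.1.le, hu.2.le⟩).div_const (u ^ 2)).tsum_eq
  -- range of Φ
  have hΦmem : ∀ t, 0 ≤ t → ∀ x ∈ Set.Icc (0:ℝ) 1, Φ t x ∈ Set.Icc (0:ℝ) 1 := by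
    intro t ht x hx
    refine ⟨(hΦ t ht x hx).nonneg fun j => mul_nonneg (hPnn t ht j) (pow_nonneg hx.1 j), ?_⟩
    exact hasSum_le (fun j => mul_le_of_le_one_right (hPnn t ht j) (pow_le_one₀ hx.1 hx.2))
      (hΦ t ht x hx) (hPsum t ht)
  -- Lipschitz
  obtain ⟨K, hK⟩ : ∃ K : NNReal, LipschitzOnWith K f (Set.Icc 0 1) := by
    have hs : Summable (fun k : ℕ => |(k : ℝ) * a k|) := hcrit.summable.abs
    refine ⟨Real.toNNReal (∑' k : ℕ, |(k : ℝ) * a k|), LipschitzOnWith.of_dist_le_mul ?_⟩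
    intro x hx y hy
    rw [Real.coe_toNNReal _ (tsum_nonneg fun k => abs_nonneg _), Real.dist_eq, Real.dist_eq]
    have h := (hf x hx).sub (hf y hy)
    have hle := hs.hasSum.mul_right |x - y|
    rw [← Real.norm_eq_abs, ← h.tsum_eq]
    refine tsum_of_norm_bounded hle fun k => ?_
    have h2 : |x ^ k - y ^ k| ≤ k * |x - y| := by
      have := abs_pow_sub_pow_le x y k
      refine this.trans ?_
      have hm : max |x| |y| ≤ 1 := by
        rw [abs_of_nonneg hx.1, abs_of_nonneg hy.1]; exact max_le hx.2 hy.2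
      have h3 : max |x| |y| ^ (k - 1) ≤ 1 := pow_le_one₀ (le_max_of_le_left (abs_nonneg _)) hm
      have h4 : 0 ≤ |x - y| * k := by positivity
      nlinarith
    rw [Real.norm_eq_abs, ← mul_sub, abs_mul, abs_mul, Nat.abs_cast]
    have := mul_le_mul_of_nonneg_left h2 (abs_nonneg (a k))
    linarith
  -- F
  set F : ℝ → ℝ := fun t => Φ t 0 with hFdef
  have hFmem : ∀ t, 0 ≤ t → F t ∈ Set.Icc (0:ℝ) 1 := fun t ht => hΦmem t ht 0 h0mem
  have hFd : ∀ t, 0 ≤ t → HasDerivAt F (f (F t)) t := fun t ht => hKol 0 h0mem t ht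
  have hF0 : F 0 = 0 := hΦ0 0 h0mem
  have hf0 : f 0 = a 0 := by
    have h := hasSum_single (f := fun k : ℕ => a k * (0:ℝ) ^ k) 0 (fun k hk => by simp [hk])
    have := (hf 0 h0mem).unique h
    simpa using this
  have hsemi : ∀ t, 0 ≤ t → ∀ s, 0 ≤ s → Φ t (F s) = F (t + s) := by
    intro t ht s hs
    have hFs := hFmem s hs
    have hd2 : ∀ τ, 0 ≤ τ → HasDerivAt (fun τ => F (τ + s)) (f (F (τ + s))) τ := fun τ hτ =>
      (hFd (τ + s) (by linarith)).comp_add_const τ s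
    have := ODE_solution_unique_of_mem_Icc_right (v := fun _ => f) (s := fun _ => Set.Icc 0 1)
      (K := K) (f := fun τ => Φ τ (F s)) (g := fun τ => F (τ + s)) (a := 0) (b := t)
      (fun _ _ => hK)
      (fun τ hτ => (hKol _ hFs τ hτ.1).continuousAt.continuousWithinAt)
      (fun τ hτ => (hKol _ hFs τ hτ.1).hasDerivWithinAt)
      (fun τ hτ => hΦmem τ hτ.1 _ hFs)
      (fun τ hτ => (hd2 τ hτ.1).continuousAt.continuousWithinAt)
      (fun τ hτ => (hd2 τ hτ.1).hasDerivWithinAt)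
      (fun τ hτ => hFmem _ (by linarith [hτ.1]))
      (by simp [hΦ0 _ hFs])
    exact this ⟨ht, le_rfl⟩
  -- P t 1
  have hP1 : ∀ t, 0 ≤ t → P t 1 * a 0 = f (F t) := by
    intro t ht
    -- derivative of Φ t at 0 within [0,1]
    have hbd : ∀ x ∈ Set.Icc (0:ℝ) 1, |Φ t x - F t - P t 1 * x| ≤ x ^ 2 := by
      intro x hx
      have hFt : F t = P t 0 := by
        have h := hasSum_single (f := fun k : ℕ => P t k * (0:ℝ) ^ k) 0 (fun k hk => by simp [hk])
        have := (hΦ t ht 0 h0mem).unique h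
        simpa using this
      have h1 := (hasSum_nat_add_iff' 2).2 (hΦ t ht x hx)
      have h2 := (hasSum_nat_add_iff' 2).2 (hPsum t ht)
      simp only [Finset.sum_range_succ, Finset.sum_range_zero, zero_add, pow_zero, mul_one,
        pow_one] at h1 h2
      have e : Φ t x - F t - P t 1 * x = Φ t x - (P t 0 + P t 1 * x) := by rw [hFt]; ring
      rw [e, abs_of_nonneg (h1.nonneg fun j => mul_nonneg (hPnn t ht _) (pow_nonneg hx.1 _))]
      have h3 := hasSum_le (fun j => by
        have : x ^ (j + 2) ≤ x ^ 2 := pow_le_pow_of_le_one hx.1 hx.2 (by omega)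
        exact mul_le_mul_of_nonneg_left this (hPnn t ht (j + 2))) h1 (h2.mul_right (x ^ 2))
      have h4 := hPnn t ht 0
      have h5 := hPnn t ht 1
      nlinarith [sq_nonneg x]
    have hs1 : Filter.Tendsto (fun s : ℝ => s⁻¹ * (F (t + s) - F t)) (𝓝[>] 0) (𝓝 (f (F t))) := by
      simpa using (hFd t ht).tendsto_slope_zero_right
    have hs2 : Filter.Tendsto (fun s : ℝ => s⁻¹ * F s) (𝓝[>] 0) (𝓝 (a 0)) := by
      have := (hFd 0 le_rfl).tendsto_slope_zero_right
      rw [hF0, hf0] at this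
      simpa using this
    have hFc : Filter.Tendsto F (𝓝[>] 0) (𝓝 0) := by
      have := (hFd 0 le_rfl).continuousAt.tendsto
      rw [hF0] at this
      exact this.mono_left nhdsWithin_le_nhds
    have hz : Filter.Tendsto (fun s : ℝ => s⁻¹ * (F (t + s) - F t) - P t 1 * (s⁻¹ * F s))
        (𝓝[>] 0) (𝓝 0) := by
      have hb0 : Filter.Tendsto (fun s : ℝ => (s⁻¹ * F s) * F s) (𝓝[>] 0) (𝓝 0) := by
        simpa using hs2.mul hFc
      refine squeeze_zero_norm' ?_ hb0
      filter_upwards [self_mem_nhdsWithin] with s hs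
      have hs : (0:ℝ) < s := hs
      have h := hbd (F s) (hFmem s hs.le)
      rw [hsemi t ht s hs.le] at h
      have e : s⁻¹ * (F (t + s) - F t) - P t 1 * (s⁻¹ * F s) =
        s⁻¹ * (F (t + s) - F t - P t 1 * F s) := by ring
      rw [e, Real.norm_eq_abs, abs_mul, abs_of_pos (inv_pos.2 hs)]
      have := mul_le_mul_of_nonneg_left h (inv_pos.2 hs).le
      linarith
    have h3 := tendsto_nhds_unique hz (hs1.sub (hs2.const_mul (P t 1)))
    linarith
  -- G = 1 - F
  set G : ℝ → ℝ := fun t => 1 - F t with hGdef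
  have hGmem : ∀ t, 0 ≤ t → G t ∈ Set.Icc (0:ℝ) 1 := fun t ht =>
    ⟨by linarith [(hFmem t ht).2], by linarith [(hFmem t ht).1]⟩
  have hGd : ∀ t, 0 ≤ t → HasDerivAt G (-f (1 - G t)) t := by
    intro t ht
    have := (hFd t ht).const_sub 1
    simpa [hGdef] using this
  have hG0 : G 0 = 1 := by simp [hGdef, hF0]
  have hGpos : ∀ t, 0 ≤ t → 0 < G t := by
    have hd : ∀ t, 0 ≤ t → HasDerivAt (fun t => G t * Real.exp (b / 2 * t))
        (-f (1 - G t) * Real.exp (b / 2 * t) + G t * (Real.exp (b / 2 * t) * (b / 2))) t := by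
      intro t ht
      have h1 := ((hasDerivAt_id t).const_mul (b / 2)).exp
      simp only [id, mul_one] at h1
      exact (hGd t ht).mul h1
    have hmono : MonotoneOn (fun t => G t * Real.exp (b / 2 * t)) (Set.Ici 0) := by
      refine monotoneOn_of_hasDerivWithinAt_nonneg (convex_Ici 0)
        (fun t ht => (hd t ht).continuousAt.continuousWithinAt)
        (fun t ht => (hd t (interior_subset ht)).hasDerivWithinAt) ?_
      intro t ht
      have ht : 0 ≤ t := interior_subset ht
      have h1 := hfub _ (hGmem t ht)
      obtain ⟨h2, h3⟩ := hGmem t ht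
      have h4 : G t ^ 2 ≤ G t := by nlinarith
      have h5 : b / 2 * G t ^ 2 ≤ b / 2 * G t := mul_le_mul_of_nonneg_left h4 (by linarith)
      have h6 : 0 ≤ (b / 2 * G t - f (1 - G t)) * Real.exp (b / 2 * t) :=
        mul_nonneg (by linarith) (Real.exp_pos _).le
      linarith
    intro t ht
    have := hmono (show (0:ℝ) ∈ Set.Ici 0 by simp) (show t ∈ Set.Ici (0:ℝ) from ht) ht
    simp only [hG0, mul_zero, Real.exp_zero, mul_one] at this
    by_contra hcon
    push Not at hcon
    have := mul_nonpos_of_nonpos_of_nonneg hcon (Real.exp_pos (b / 2 * t)).le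
    linarith
  have hHd : ∀ t, 0 ≤ t → HasDerivAt (fun t => (G t)⁻¹) (f (1 - G t) / G t ^ 2) t := by
    intro t ht
    have := (hGd t ht).inv (hGpos t ht).ne'
    rw [neg_neg] at this
    exact this
  have hHlb : ∀ t, 0 ≤ t → a (m + 2) * t ≤ (G t)⁻¹ := by
    have hd : ∀ t, 0 ≤ t → HasDerivAt (fun t => (G t)⁻¹ - a (m + 2) * t)
        (f (1 - G t) / G t ^ 2 - a (m + 2)) t := by
      intro t ht
      have h1 := ((hasDerivAt_id t).const_mul (a (m + 2)))
      simp only [id, mul_one] at h1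
      exact (hHd t ht).sub h1
    have hmono : MonotoneOn (fun t => (G t)⁻¹ - a (m + 2) * t) (Set.Ici 0) := by
      refine monotoneOn_of_hasDerivWithinAt_nonneg (convex_Ici 0)
        (fun t ht => (hd t ht).continuousAt.continuousWithinAt)
        (fun t ht => (hd t (interior_subset ht)).hasDerivWithinAt) ?_
      intro t ht
      have ht : 0 ≤ t := interior_subset ht
      rw [sub_nonneg, le_div_iff₀ (pow_pos (hGpos t ht) 2)]
      exact hflb _ (hGmem t ht)
    intro t ht
    have := hmono (show (0:ℝ) ∈ Set.Ici 0 by simp) (show t ∈ Set.Ici (0:ℝ) from ht) ht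
    simp only [hG0, mul_zero, inv_one, sub_zero] at this
    linarith
  have hHtop : Filter.Tendsto (fun t => (G t)⁻¹) Filter.atTop Filter.atTop := by
    refine Filter.tendsto_atTop_mono' _ ?_ (Filter.tendsto_id.const_mul_atTop hm)
    filter_upwards [Filter.eventually_ge_atTop 0] with t ht
    exact hHlb t ht
  have hGlim : Filter.Tendsto G Filter.atTop (𝓝[>] 0) := by
    have := tendsto_inv_atTop_nhdsGT_zero.comp hHtop
    refine this.congr fun t => ?_
    simp
  have hgG := hglim.comp hGlim
  have hHt := aux_avg (fun t => (G t)⁻¹) (fun t => f (1 - G t) / G t ^ 2) (b / 2) hHd hgG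
  have hfin := ((hgG.mul ((hHt.inv₀ (by linarith)).pow 2))).div_const (a 0)
  have e : b / 2 * (b / 2)⁻¹ ^ 2 / a 0 = 2 / (b * a 0) := by
    field_simp
  rw [e] at hfin
  refine hfin.congr' ?_
  filter_upwards [Filter.eventually_gt_atTop 0] with t ht
  have h1 := hP1 t ht.le
  have h2 := (hGpos t ht.le).ne'
  have h3 : f (1 - G t) = P t 1 * a 0 := by rw [h1]; simp [hGdef]
  simp only [Function.comp]
  rw [h3]
  field_simp
end

section
/- In the noncritical case, the constant A := q·exp(∫_0^q [1/(s−q) − f'(q)/f(s)] ds) is finite, and the Q-process return probability Q_{11}(t) = P_{11}(t)/β^t converges to |ln β|·A/a_0 as t → ∞. -/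
open scoped Topology


lemma aux_pow (s q : ℝ) (hs : 0 ≤ s) (hsq : s ≤ q) (k : ℕ) :
    0 ≤ s ^ k - q ^ k - k * q ^ (k - 1) * (s - q) ∧
    q * (s ^ k - q ^ k - k * q ^ (k - 1) * (s - q)) ≤ k * ((k:ℝ) - 1) * q ^ (k - 1) * (s - q) ^ 2 := by
  have hq : 0 ≤ q := hs.trans hsq
  induction k with
  | zero => simp
  | succ k ih =>
    obtain ⟨h1, h2⟩ := ih
    have hk : (k:ℝ) * q ^ (k - 1) * q = k * q ^ k := by
      rcases k with _ | k
      · simp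
      · simp only [Nat.add_sub_cancel]; ring
    have hkk : (k:ℝ) * ((k:ℝ) - 1) * q ^ (k - 1) * q = k * ((k:ℝ) - 1) * q ^ k := by
      linear_combination ((k:ℝ) - 1) * hk
    have e : s ^ (k+1) - q ^ (k+1) - ((k+1 : ℕ):ℝ) * q ^ (k + 1 - 1) * (s - q)
        = s * (s ^ k - q ^ k - k * q ^ (k - 1) * (s - q)) + k * q ^ (k - 1) * (s - q) ^ 2 := by
      simp only [Nat.add_sub_cancel]
      push_cast
      linear_combination (s - q) * hk
    have hp : 0 ≤ q ^ (k - 1) := pow_nonneg hq _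
    have hp' : 0 ≤ q ^ k := pow_nonneg hq _
    have hk0 : (0:ℝ) ≤ k := k.cast_nonneg
    rw [e]
    constructor
    · positivity
    · simp only [Nat.add_sub_cancel]
      push_cast
      have h0 : 0 ≤ q * (s ^ k - q ^ k - k * q ^ (k - 1) * (s - q)) := mul_nonneg hq h1
      have h3 : s * (q * (s ^ k - q ^ k - k * q ^ (k - 1) * (s - q)))
          ≤ q * (k * ((k:ℝ) - 1) * q ^ (k - 1) * (s - q) ^ 2) :=
        (mul_le_mul_of_nonneg_right hsq h0).trans (mul_le_mul_of_nonneg_left h2 hq)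
      have h4 : q * (k * ((k:ℝ) - 1) * q ^ (k - 1) * (s - q) ^ 2)
          = k * ((k:ℝ) - 1) * q ^ k * (s - q) ^ 2 := by
        linear_combination (s - q) ^ 2 * hkk
      have h5 : q * (k * q ^ (k - 1) * (s - q) ^ 2) = k * q ^ k * (s - q) ^ 2 := by
        linear_combination (s - q) ^ 2 * hk
      have h6 : 0 ≤ k * q ^ k * (s - q) ^ 2 := by positivity
      nlinarith

lemma aux_lip (a : ℕ → ℝ) (f : ℝ → ℝ)
    (hf : ∀ x ∈ Set.Icc (0:ℝ) 1, HasSum (fun k : ℕ => a k * x ^ k) (f x))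
    (m : ℝ) (hm : HasSum (fun k : ℕ => (k : ℝ) * a k) m) :
    ∃ K : NNReal, LipschitzOnWith K f (Set.Icc 0 1) := by
  have hs : Summable (fun k : ℕ => |(k:ℝ) * a k|) := hm.summable.abs
  refine ⟨⟨∑' k : ℕ, |(k:ℝ) * a k|, tsum_nonneg fun k => abs_nonneg _⟩, ?_⟩
  refine LipschitzOnWith.of_dist_le_mul fun x hx y hy => ?_
  simp only [Real.dist_eq, NNReal.coe_mk]
  have h1 : HasSum (fun k : ℕ => |(k:ℝ) * a k| * |x - y|) ((∑' k : ℕ, |(k:ℝ) * a k|) * |x - y|) :=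
    hs.hasSum.mul_right _
  have h2 := (hf x hx).sub (hf y hy)
  have hb : ∀ k : ℕ, |a k * x ^ k - a k * y ^ k| ≤ |(k:ℝ) * a k| * |x - y| := by
    intro k
    rw [← mul_sub, abs_mul, abs_mul, Nat.abs_cast]
    have h3 := abs_pow_sub_pow_le x y k
    have h4 : max |x| |y| ^ (k - 1) ≤ 1 := by
      apply pow_le_one₀ (by positivity)
      rw [abs_of_nonneg hx.1, abs_of_nonneg hy.1]
      exact max_le hx.2 hy.2
    have h5 : |x ^ k - y ^ k| ≤ |x - y| * k :=
      h3.trans (mul_le_of_le_one_right (by positivity) h4)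
    calc |a k| * |x ^ k - y ^ k| ≤ |a k| * (|x - y| * k) := by gcongr
      _ = _ := by ring
  rw [abs_le]
  constructor
  · rw [← neg_le_neg_iff, neg_neg]
    exact hasSum_le (fun k => by have := (abs_le.1 (hb k)).1; linarith) h2.neg h1
  · exact hasSum_le (fun k => (abs_le.1 (hb k)).2) h2 h1

lemma aux_uniq (f : ℝ → ℝ) (K : NNReal) (hL : LipschitzOnWith K f (Set.Icc 0 1)) (u v : ℝ → ℝ)
    (hu : ∀ t, 0 ≤ t → HasDerivAt u (f (u t)) t) (hv : ∀ t, 0 ≤ t → HasDerivAt v (f (v t)) t)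
    (hu1 : ∀ t, 0 ≤ t → u t ∈ Set.Icc (0:ℝ) 1) (hv1 : ∀ t, 0 ≤ t → v t ∈ Set.Icc (0:ℝ) 1)
    (h0 : u 0 = v 0) (t : ℝ) (ht : 0 ≤ t) : u t = v t := by
  refine ODE_solution_unique_of_mem_Icc_right (v := fun _ => f) (s := fun _ => Set.Icc 0 1)
    (K := K) (a := 0) (b := t) (fun _ _ => hL) ?_ ?_ ?_ ?_ ?_ ?_ h0 ⟨ht, le_rfl⟩
  · exact fun s hs => (hu s hs.1).continuousAt.continuousWithinAt
  · exact fun s hs => (hu s hs.1).hasDerivWithinAt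
  · exact fun s hs => hu1 s hs.1
  · exact fun s hs => (hv s hs.1).continuousAt.continuousWithinAt
  · exact fun s hs => (hv s hs.1).hasDerivWithinAt
  · exact fun s hs => hv1 s hs.1

/-- right derivative at zero of a probability generating function -/
lemma aux_deriv (p : ℕ → ℝ) (F : ℝ → ℝ) (hp : ∀ j, 0 ≤ p j) (hs : HasSum p 1)
    (hF : ∀ x ∈ Set.Icc (0:ℝ) 1, HasSum (fun j : ℕ => p j * x ^ j) (F x)) :
    HasDerivWithinAt F (p 1) (Set.Icc 0 1) 0 := by
  rw [hasDerivWithinAt_iff_isLittleO]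
  have h1 : (fun x : ℝ => ‖x - 0‖ ^ 2) =o[𝓝[Set.Icc 0 1] 0] fun x : ℝ => x - 0 :=
    (Asymptotics.isLittleO_pow_sub_sub (0:ℝ) (by norm_num)).mono nhdsWithin_le_nhds
  refine Asymptotics.IsBigO.trans_isLittleO ?_ h1
  refine Asymptotics.IsBigO.of_bound 1 ?_
  filter_upwards [self_mem_nhdsWithin] with x hx
  have e0 := hF 0 ⟨le_rfl, zero_le_one⟩
  have ex := hF x hx
  have e1 : HasSum (fun j : ℕ => if j = 1 then x * p 1 else 0) (x * p 1) := by
    exact hasSum_ite_eq 1 (x * p 1)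
  have e2 := (ex.sub e0).sub e1
  have e3 : HasSum (fun j => p j * x ^ 2) (1 * x ^ 2) := hs.mul_right _
  have hx0 := hx.1
  have key : ∀ j : ℕ, 0 ≤ p j * x ^ j - p j * 0 ^ j - (if j = 1 then x * p 1 else 0) ∧
      p j * x ^ j - p j * 0 ^ j - (if j = 1 then x * p 1 else 0) ≤ p j * x ^ 2 := by
    intro j
    rcases j with _ | _ | j
    · have := mul_nonneg (hp 0) (sq_nonneg x)
      simpa using this
    · have := mul_nonneg (hp 1) (sq_nonneg x)
      simp only [zero_add, pow_one, mul_zero, if_true]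
      constructor <;> linarith
    · have h5 : x ^ (j + 1 + 1) ≤ x ^ 2 := pow_le_pow_of_le_one hx.1 hx.2 (by omega)
      have h6 : 0 ≤ x ^ (j + 1 + 1) := by positivity
      have h7 := hp (j+1+1)
      simp only [show ¬ (j + 1 + 1 = 1) by omega, if_false]
      rw [zero_pow (by omega)]
      simp only [mul_zero, sub_zero]
      exact ⟨by positivity, by gcongr⟩
  have k1 := hasSum_le (fun j => (key j).1) hasSum_zero e2
  have k2 := hasSum_le (fun j => (key j).2) e2 e3
  simp only [smul_eq_mul, sub_zero, Real.norm_eq_abs]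
  rw [abs_of_nonneg k1, abs_of_nonneg (by positivity)]
  simpa [abs_of_nonneg hx0] using k2

theorem stmt_3
    (a : ℕ → ℝ) (f : ℝ → ℝ) (P : ℝ → ℕ → ℝ) (Φ : ℝ → ℝ → ℝ)
    (ha : ∀ k : ℕ, k ≠ 1 → 0 ≤ a k)
    (ha0 : 0 < a 0)
    (ha1 : HasSum (fun k : ℕ => if k = 1 then (0:ℝ) else a k) (-(a 1)))
    (ha01 : a 0 < -(a 1))
    (hf : ∀ x ∈ Set.Icc (0:ℝ) 1, HasSum (fun k : ℕ => a k * x ^ k) (f x))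
    (hPnn : ∀ t : ℝ, 0 ≤ t → ∀ j : ℕ, 0 ≤ P t j)
    (hPsum : ∀ t : ℝ, 0 ≤ t → HasSum (fun j : ℕ => P t j) 1)
    (hΦ : ∀ t : ℝ, 0 ≤ t → ∀ x ∈ Set.Icc (0:ℝ) 1, HasSum (fun j : ℕ => P t j * x ^ j) (Φ t x))
    (hΦ0 : ∀ x ∈ Set.Icc (0:ℝ) 1, Φ 0 x = x)
    (hKol : ∀ x ∈ Set.Icc (0:ℝ) 1, ∀ t : ℝ, 0 ≤ t → HasDerivAt (fun s => Φ s x) (f (Φ t x)) t)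
    (m : ℝ)
    (hm : HasSum (fun k : ℕ => (k : ℝ) * a k) m)
    (hnoncrit : m ≠ 0)
    (q fq β : ℝ)
    (hq : q = sInf {x : ℝ | x ∈ Set.Icc (0:ℝ) 1 ∧ f x = 0})
    (hfq : HasSum (fun k : ℕ => (k : ℝ) * a k * q ^ (k - 1)) fq)
    (hβ : β = Real.exp fq)
    (hβlt : β < 1)
    (b : ℝ)
    (hb : HasSum (fun k : ℕ => (k : ℝ) * ((k : ℝ) - 1) * a k * q ^ (k - 1)) b)
    :
    IntervalIntegrable (fun s : ℝ => 1 / (s - q) - fq / f s) MeasureTheory.volume 0 q ∧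
    Filter.Tendsto (fun t : ℝ => P t 1 / β ^ t) Filter.atTop
      (𝓝 (|Real.log β| * (q * Real.exp (∫ s in (0:ℝ)..q, (1 / (s - q) - fq / f s))) / a 0)) := by
  obtain ⟨K, hL⟩ := aux_lip a f hf m hm
  have hfc : ContinuousOn f (Set.Icc 0 1) := hL.continuousOn
  have hf0 : f 0 = a 0 := by
    have h1 := hf 0 ⟨le_rfl, zero_le_one⟩
    have h2 : HasSum (fun k : ℕ => a k * 0 ^ k) (a 0) := by
      convert hasSum_ite_eq 0 (a 0) using 2 with k
      by_cases hk : k = 0 <;> simp [hk]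
    exact h1.unique h2
  have hf1 : f 1 = 0 := by
    have h1 := hf 1 ⟨zero_le_one, le_rfl⟩
    have h2 : HasSum (fun k : ℕ => a k * 1 ^ k) (-(a 1) + a 1) := by
      convert ha1.add (hasSum_ite_eq 1 (a 1)) using 2 with k
      by_cases hk : k = 1 <;> simp [hk]
    rw [h1.unique h2]; ring
  have hfqneg : fq < 0 := by
    rw [hβ] at hβlt
    exact Real.exp_lt_one_iff.1 hβlt
  -- the set of zeros
  have hSc : IsClosed {x : ℝ | x ∈ Set.Icc (0:ℝ) 1 ∧ f x = 0} :=
    hfc.preimage_isClosed_of_isClosed isClosed_Icc isClosed_singleton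
  have hSb : BddBelow {x : ℝ | x ∈ Set.Icc (0:ℝ) 1 ∧ f x = 0} := ⟨0, fun x hx => hx.1.1⟩
  have hSn : {x : ℝ | x ∈ Set.Icc (0:ℝ) 1 ∧ f x = 0}.Nonempty :=
    ⟨1, ⟨zero_le_one, le_rfl⟩, hf1⟩
  have hqS : q ∈ {x : ℝ | x ∈ Set.Icc (0:ℝ) 1 ∧ f x = 0} := by
    rw [hq]; exact hSc.csInf_mem hSn hSb
  obtain ⟨hqI, hfq0⟩ := hqS
  have hqpos : 0 < q := by
    rcases hqI.1.lt_or_eq with h | h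
    · exact h
    · rw [← h, hf0] at hfq0; linarith
  -- Taylor estimates
  have taylor : ∀ s, 0 ≤ s → s ≤ q → 0 ≤ f s - fq * (s - q) ∧
      q * (f s - fq * (s - q)) ≤ b * (s - q) ^ 2 := by
    intro s hs hsq
    have e1 := ((hf s ⟨hs, hsq.trans hqI.2⟩).sub (hf q hqI)).sub (hfq.mul_right (s - q))
    rw [hfq0, sub_zero] at e1
    have e2 := e1.mul_left q
    have e3 := hb.mul_right ((s - q) ^ 2)
    have hD : ∀ k : ℕ, 0 ≤ a k * s ^ k - a k * q ^ k - k * a k * q ^ (k - 1) * (s - q) ∧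
        q * (a k * s ^ k - a k * q ^ k - k * a k * q ^ (k - 1) * (s - q))
          ≤ k * ((k:ℝ) - 1) * a k * q ^ (k - 1) * (s - q) ^ 2 := by
      intro k
      by_cases hk : k = 1
      · subst hk
        simp only [pow_one, Nat.cast_one, Nat.sub_self, pow_zero]
        constructor <;> apply le_of_eq <;> ring
      · have hak := ha k hk
        obtain ⟨p1, p2⟩ := aux_pow s q hs hsq k
        have p1' := mul_nonneg hak p1
        have p2' := mul_le_mul_of_nonneg_left p2 hak
        constructor <;> linarith
    exact ⟨hasSum_le (fun k => (hD k).1) hasSum_zero e1, hasSum_le (fun k => (hD k).2) e2 e3⟩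
  have hflow : ∀ s, 0 ≤ s → s ≤ q → -fq * (q - s) ≤ f s := by
    intro s hs hsq
    have := (taylor s hs hsq).1
    linarith
  have hfpos : ∀ s, 0 ≤ s → s < q → 0 < f s := by
    intro s hs hsq
    have := hflow s hs hsq.le
    have h2 : 0 < -fq * (q - s) := mul_pos (by linarith) (by linarith)
    linarith
  set g : ℝ → ℝ := fun s : ℝ => 1 / (s - q) - fq / f s with hg
  have hgc : ContinuousOn g (Set.Ico 0 q) := by
    have hfc' : ContinuousOn f (Set.Ico 0 q) :=
      hfc.mono fun s hs => ⟨hs.1, hs.2.le.trans hqI.2⟩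
    apply ContinuousOn.sub
    · apply ContinuousOn.div continuousOn_const (by fun_prop)
      intro s hs; exact (sub_neg.2 hs.2).ne
    · apply ContinuousOn.div continuousOn_const hfc'
      intro s hs; exact (hfpos s hs.1 hs.2).ne'
  have hgb : ∀ s ∈ Set.Ioo 0 q, ‖g s‖ ≤ b / q / (-fq) := by
    intro s hs
    have h1 := hfpos s hs.1.le hs.2
    have h2 := hflow s hs.1.le hs.2.le
    obtain ⟨h3, h4⟩ := taylor s hs.1.le hs.2.le
    have h5 : 0 < q - s := by linarith [hs.2]
    have h6 : 0 < -fq := by linarith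
    have e : g s = -((f s - fq * (s - q)) / ((q - s) * f s)) := by
      have : s - q ≠ 0 := by linarith
      have h7 : q - s ≠ 0 := h5.ne'
      simp only [hg]
      rw [show s - q = -(q - s) by ring]
      field_simp
      ring
    rw [e, norm_neg, Real.norm_eq_abs, abs_of_nonneg (by positivity)]
    have h8 : f s - fq * (s - q) ≤ b / q * (s - q) ^ 2 := by
      rw [div_mul_eq_mul_div, le_div_iff₀ hqpos]; linarith
    have h9 : 0 ≤ b / q := by
      have : 0 < (s - q) ^ 2 := by
        have := pow_pos h5 2
        nlinarith
      by_contra h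
      have := mul_neg_of_neg_of_pos (not_le.1 h) this
      linarith
    rw [div_le_div_iff₀ (by positivity) h6]
    calc (f s - fq * (s - q)) * -fq ≤ (b / q * (s - q) ^ 2) * -fq := by gcongr
      _ = b / q * ((q - s) * (-fq * (q - s))) := by ring
      _ ≤ b / q * ((q - s) * f s) := by gcongr
  have hgi : IntervalIntegrable g MeasureTheory.volume 0 q := by
    rw [intervalIntegrable_iff_integrableOn_Ioo_of_le hqpos.le]
    refine MeasureTheory.IntegrableOn.of_bound (by simp) ?_ (b / q / (-fq)) ?_
    · exact (hgc.mono fun s hs => ⟨hs.1.le, hs.2⟩).aestronglyMeasurable measurableSet_Ioo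
    · exact (MeasureTheory.ae_restrict_mem measurableSet_Ioo).mono hgb
  refine ⟨hgi, ?_⟩
  -- the flow
  have hΦI : ∀ t, 0 ≤ t → ∀ x ∈ Set.Icc (0:ℝ) 1, Φ t x ∈ Set.Icc (0:ℝ) 1 := by
    intro t ht x hx
    constructor
    · exact (hΦ t ht x hx).nonneg fun j => mul_nonneg (hPnn t ht j) (pow_nonneg hx.1 _)
    · exact hasSum_le (fun j => mul_le_of_le_one_right (hPnn t ht j) (pow_le_one₀ hx.1 hx.2))
        (hΦ t ht x hx) (hPsum t ht)
  have h0I : (0:ℝ) ∈ Set.Icc (0:ℝ) 1 := ⟨le_rfl, zero_le_one⟩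
  set u : ℝ → ℝ := fun s => Φ s 0 with hu
  have hu0 : u 0 = 0 := hΦ0 0 h0I
  have hud : ∀ t, 0 ≤ t → HasDerivAt u (f (u t)) t := hKol 0 h0I
  have huI : ∀ t, 0 ≤ t → u t ∈ Set.Icc (0:ℝ) 1 := fun t ht => hΦI t ht 0 h0I
  have hsemi : ∀ t, 0 ≤ t → ∀ h, 0 ≤ h → Φ t (u h) = u (t + h) := by
    intro t ht h hh
    refine aux_uniq f K hL (fun s => Φ s (u h)) (fun s => u (s + h)) (hKol (u h) (huI h hh)) ?_
      (fun s hs => hΦI s hs _ (huI h hh)) (fun s hs => huI _ (by linarith)) ?_ t ht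
    · intro s hs
      exact (hud (s + h) (by linarith)).comp_add_const s h
    · simp only [zero_add]; exact hΦ0 _ (huI h hh)
  have hP1 : ∀ t, 0 ≤ t → P t 1 = f (u t) / a 0 := by
    intro t ht
    have d1 : HasDerivWithinAt (Φ t) (P t 1) (Set.Icc 0 1) (u 0) := by
      rw [hu0]
      exact aux_deriv (P t) (Φ t) (hPnn t ht) (hPsum t ht) (hΦ t ht)
    have d2 : HasDerivWithinAt u (f (u 0)) (Set.Ici 0) 0 := (hud 0 le_rfl).hasDerivWithinAt
    have d3 : HasDerivWithinAt (Φ t ∘ u) (P t 1 * f (u 0)) (Set.Ici 0) 0 :=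
      d1.comp (0:ℝ) d2 (fun s hs => huI s hs)
    have d4 : HasDerivWithinAt (fun h => u (t + h)) (f (u t)) (Set.Ici 0) 0 := by
      have := hud (t + 0) (by linarith)
      have := (this.comp_const_add t 0).hasDerivWithinAt (s := Set.Ici 0)
      simpa using this
    have d5 : HasDerivWithinAt (Φ t ∘ u) (f (u t)) (Set.Ici 0) 0 :=
      d4.congr (fun h hh => hsemi t ht h hh) (hsemi t ht 0 le_rfl)
    have := (uniqueDiffWithinAt_Ici (0:ℝ)).eq_deriv _ d3 d5
    rw [hu0, hf0] at this
    rw [← this]; field_simp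
  have huq : ∀ t, 0 ≤ t → u t ≤ q := by
    intro t ht
    have e1 : Φ t q = q := by
      refine aux_uniq f K hL (fun s => Φ s q) (fun _ => q) (hKol q hqI) ?_
        (fun s hs => hΦI s hs _ hqI) (fun s hs => hqI) (hΦ0 q hqI) t ht
      intro s hs
      simp only [hfq0]
      exact hasDerivAt_const s q
    rw [← e1]
    refine hasSum_le (fun j => ?_) (hΦ t ht 0 h0I) (hΦ t ht q hqI)
    exact mul_le_mul_of_nonneg_left (pow_le_pow_left₀ le_rfl hqpos.le j) (hPnn t ht j)
  have hwd : ∀ c t, 0 ≤ t → HasDerivAt (fun s => (q - u s) * Real.exp (c * s))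
      ((c * (q - u t) - f (u t)) * Real.exp (c * t)) t := by
    intro c t ht
    have h1 : HasDerivAt (fun s => q - u s) (-f (u t)) t := (hud t ht).const_sub q
    have h2 : HasDerivAt (fun s => Real.exp (c * s)) (Real.exp (c * t) * (c * 1)) t :=
      ((hasDerivAt_id t).const_mul c).exp
    refine (h1.mul h2).congr_deriv ?_
    ring
  have hfup : ∀ x, 0 ≤ x → x ≤ q → f x ≤ K * (q - x) := by
    intro x hx hxq
    have := hL.dist_le_mul x ⟨hx, hxq.trans hqI.2⟩ q hqI
    rw [Real.dist_eq, Real.dist_eq, hfq0, sub_zero, abs_sub_comm, abs_of_nonneg (sub_nonneg.2 hxq)]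
      at this
    exact (le_abs_self _).trans this
  have hult : ∀ t, 0 ≤ t → u t < q := by
    intro t ht
    have hmono : MonotoneOn (fun s => (q - u s) * Real.exp (K * s)) (Set.Ici 0) := by
      apply monotoneOn_of_deriv_nonneg (convex_Ici 0)
      · exact fun s hs => (hwd K s hs).continuousAt.continuousWithinAt
      · intro s hs
        rw [interior_Ici] at hs
        exact (hwd K s (le_of_lt hs)).differentiableAt.differentiableWithinAt
      · intro s hs
        rw [interior_Ici] at hs
        have hs0 : 0 ≤ s := le_of_lt hs
        rw [(hwd K s hs0).deriv]
        have := hfup (u s) (huI s hs0).1 (huq s hs0)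
        exact mul_nonneg (by linarith) (Real.exp_pos _).le
    have h1 := hmono (Set.mem_Ici.2 le_rfl) (Set.mem_Ici.2 ht) ht
    simp only [hu0, mul_zero, Real.exp_zero, sub_zero, mul_one] at h1
    have h2 : 0 < (q - u t) * Real.exp (K * t) := by linarith
    have := pos_of_mul_pos_left h2 (Real.exp_pos _).le
    linarith
  have hwle : ∀ t, 0 ≤ t → q - u t ≤ q * Real.exp (fq * t) := by
    intro t ht
    have hanti : AntitoneOn (fun s => (q - u s) * Real.exp (-fq * s)) (Set.Ici 0) := by
      apply antitoneOn_of_deriv_nonpos (convex_Ici 0)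
      · exact fun s hs => (hwd (-fq) s hs).continuousAt.continuousWithinAt
      · intro s hs
        rw [interior_Ici] at hs
        exact (hwd (-fq) s (le_of_lt hs)).differentiableAt.differentiableWithinAt
      · intro s hs
        rw [interior_Ici] at hs
        have hs0 : 0 ≤ s := le_of_lt hs
        rw [(hwd (-fq) s hs0).deriv]
        have := hflow (u s) (huI s hs0).1 (huq s hs0)
        exact mul_nonpos_of_nonpos_of_nonneg (by linarith) (Real.exp_pos _).le
    have h1 := hanti (Set.mem_Ici.2 le_rfl) (Set.mem_Ici.2 ht) ht
    simp only [hu0, mul_zero, Real.exp_zero, sub_zero, mul_one] at h1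
    have h2 : Real.exp (-fq * t) * Real.exp (fq * t) = 1 := by
      rw [← Real.exp_add, ← Real.exp_zero]; congr 1; ring
    calc q - u t = ((q - u t) * Real.exp (-fq * t)) * Real.exp (fq * t) := by
          rw [mul_assoc, h2, mul_one]
      _ ≤ q * Real.exp (fq * t) := by gcongr
  have hulim : Filter.Tendsto u Filter.atTop (𝓝 q) := by
    have h1 : Filter.Tendsto (fun t : ℝ => q * Real.exp (fq * t)) Filter.atTop (𝓝 0) := by
      have : Filter.Tendsto (fun t : ℝ => fq * t) Filter.atTop Filter.atBot :=
        Filter.tendsto_id.const_mul_atTop_of_neg hfqneg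
      simpa using (Real.tendsto_exp_atBot.comp this).const_mul q
    have h2 : Filter.Tendsto (fun t => q - u t) Filter.atTop (𝓝 0) := by
      refine tendsto_of_tendsto_of_tendsto_of_le_of_le' tendsto_const_nhds h1 ?_ ?_
      · filter_upwards [Filter.eventually_ge_atTop 0] with t ht
        exact sub_nonneg.2 (huq t ht)
      · filter_upwards [Filter.eventually_ge_atTop 0] with t ht
        exact hwle t ht
    simpa using h2.const_sub q
  -- integral identity
  have hid : ∀ t, 0 ≤ t → (q - u t) / β ^ t = q * Real.exp (∫ s in (0:ℝ)..(u t), g s) := by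
    intro t ht
    have huc : ContinuousOn u (Set.uIcc 0 t) := by
      rw [Set.uIcc_of_le ht]
      exact fun s hs => (hud s hs.1).continuousAt.continuousWithinAt
    have hfuc : ContinuousOn (fun s => f (u s)) (Set.uIcc 0 t) := by
      refine hfc.comp huc ?_
      rw [Set.uIcc_of_le ht]
      exact fun s hs => huI s hs.1
    have h1 : (∫ x in (0:ℝ)..t, (g ∘ u) x * f (u x)) = ∫ s in (u 0)..(u t), g s := by
      apply intervalIntegral.integral_comp_mul_deriv'' huc _ hfuc
      · apply hgc.mono
        rw [Set.uIcc_of_le ht]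
        rintro _ ⟨s, hs, rfl⟩
        exact ⟨(huI s hs.1).1, hult s hs.1⟩
      · intro s hs
        rw [min_eq_left ht] at hs
        exact (hud s hs.1.le).hasDerivWithinAt
    have h2 : (∫ x in (0:ℝ)..t, (g ∘ u) x * f (u x))
        = ∫ x in (0:ℝ)..t, (-f (u x) / (q - u x) - fq) := by
      apply intervalIntegral.integral_congr
      intro s hs
      rw [Set.uIcc_of_le ht] at hs
      have h3 := hult s hs.1
      have h4 := hfpos (u s) (huI s hs.1).1 h3
      have h5 : q - u s ≠ 0 := by linarith
      simp only [hg, Function.comp]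
      rw [show u s - q = -(q - u s) by ring]
      field_simp
    have h3 : (∫ x in (0:ℝ)..t, (-f (u x) / (q - u x) - fq))
        = (Real.log (q - u t) - fq * t) - (Real.log (q - u 0) - fq * 0) := by
      apply intervalIntegral.integral_eq_sub_of_hasDerivAt
        (f := fun s => Real.log (q - u s) - fq * s)
      · intro s hs
        rw [Set.uIcc_of_le ht] at hs
        have h3 := hult s hs.1
        have h5 : q - u s ≠ 0 := by linarith
        have d1 := ((hud s hs.1).const_sub q).log h5
        have d2 := (hasDerivAt_id s).const_mul fq
        rw [mul_one] at d2
        exact d1.sub d2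
      · apply ContinuousOn.intervalIntegrable
        refine ContinuousOn.sub (ContinuousOn.div hfuc.neg (continuousOn_const.sub huc) ?_)
          continuousOn_const
        intro s hs
        rw [Set.uIcc_of_le ht] at hs
        have h3 := hult s hs.1
        linarith
    rw [hu0] at h1 h3
    rw [← h1, h2, h3]
    have hβt : β ^ t = Real.exp (fq * t) := by
      rw [hβ, ← Real.exp_mul]
    have h6 : 0 < q - u t := by linarith [hult t ht]
    rw [hβt, sub_zero, mul_zero, sub_zero, Real.exp_sub, Real.exp_sub, Real.exp_log h6,
      Real.exp_log hqpos]
    field_simp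
  have hG : Filter.Tendsto (fun t => ∫ s in (0:ℝ)..(u t), g s) Filter.atTop
      (𝓝 (∫ s in (0:ℝ)..q, g s)) := by
    have hc := intervalIntegral.continuousOn_primitive_interval' hgi Set.left_mem_uIcc
    rw [Set.uIcc_of_le hqpos.le] at hc
    have hc1 := hc q ⟨hqpos.le, le_rfl⟩
    refine Filter.Tendsto.comp hc1 ?_
    rw [tendsto_nhdsWithin_iff]
    refine ⟨hulim, ?_⟩
    filter_upwards [Filter.eventually_ge_atTop 0] with t ht
    exact ⟨(huI t ht).1, huq t ht⟩
  have hratio : Filter.Tendsto (fun t => f (u t) / (q - u t)) Filter.atTop (𝓝 (-fq)) := by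
    have hup : Filter.Tendsto (fun t => -fq + b / q * (q - u t)) Filter.atTop (𝓝 (-fq)) := by
      simpa using ((hulim.const_sub q).const_mul (b / q)).const_add (-fq)
    refine tendsto_of_tendsto_of_tendsto_of_le_of_le' tendsto_const_nhds hup ?_ ?_
    · filter_upwards [Filter.eventually_ge_atTop 0] with t ht
      have h6 : 0 < q - u t := by linarith [hult t ht]
      rw [le_div_iff₀ h6]
      exact hflow _ (huI t ht).1 (huq t ht)
    · filter_upwards [Filter.eventually_ge_atTop 0] with t ht
      have h6 : 0 < q - u t := by linarith [hult t ht]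
      rw [div_le_iff₀ h6]
      have h7 := (taylor (u t) (huI t ht).1 (huq t ht)).2
      have h8 : f (u t) - fq * (u t - q) ≤ b / q * (u t - q) ^ 2 := by
        rw [div_mul_eq_mul_div, le_div_iff₀ hqpos]; linarith
      nlinarith
  have hlog : |Real.log β| = -fq := by
    rw [hβ, Real.log_exp, abs_of_neg hfqneg]
  rw [hlog]
  have hfin := (hratio.mul ((hG.rexp).const_mul q)).div_const (a 0)
  refine hfin.congr' ?_
  filter_upwards [Filter.eventually_ge_atTop 0] with t ht
  rw [← hid t ht, hP1 t ht]
  have h6 : q - u t ≠ 0 := by linarith [hult t ht]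
  field_simp
end

section
/- Assume f'(1⁻) is finite. For every i ≥ 1, t ≥ 0 and 0 ≤ x ≤ 1, the generating function of the Markov Q-process started from i particles satisfies G_i(t;x) := Σ_{j≥1} Q_{ij}(t) x^j = x·(Φ(t;qx)/q)^{i−1}·exp(∫_0^t [f'(Φ(τ;qx)) − f'(q)] dτ). -/
open scoped Topology

lemma aux_congr {g h : ℕ → ℝ} {b c : ℝ} (H : HasSum h c) (h1 : ∀ j, g j = h j) (h2 : b = c) :
    HasSum g b := by
  rw [funext h1, h2]; exact H

open Filter Set in
lemma aux_series (c : ℕ → ℝ) (H : ℝ → ℝ) (y L : ℝ) (hy0 : 0 < y) (hy1 : y ≤ 1)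
    (hc : ∀ j, 0 ≤ c j)
    (hH : ∀ z ∈ Icc (0:ℝ) 1, HasSum (fun j : ℕ => c j * z ^ j) (H z))
    (hL : HasDerivWithinAt H L (Iio y) y) :
    HasSum (fun j : ℕ => (j:ℝ) * c j * y ^ (j - 1)) L := by
  have hlim : Tendsto (slope H y) (𝓝[<] y) (𝓝 L) :=
    (hasDerivWithinAt_iff_tendsto_slope' (by simp)).1 hL
  have hev : ∀ᶠ z in 𝓝[<] y, z ∈ Ico 0 y := Ico_mem_nhdsLT hy0
  have hS : ∀ z ∈ Ico 0 y, HasSum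
      (fun j : ℕ => c j * ∑ l ∈ Finset.range j, z ^ l * y ^ (j - 1 - l)) (slope H y z) := by
    intro z hz
    have h1 := (hH z ⟨hz.1, hz.2.le.trans hy1⟩).sub (hH y ⟨hy0.le, hy1⟩)
    have h2 := h1.mul_right (z - y)⁻¹
    have hne : z - y ≠ 0 := sub_ne_zero.2 hz.2.ne
    refine aux_congr h2 (fun j => ?_) ?_
    · rw [← mul_sub, ← geom_sum₂_mul]
      field_simp
    · rw [slope_def_field, div_eq_mul_inv]
  have hSnn : ∀ z ∈ Ico 0 y, ∀ j : ℕ,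
      0 ≤ ∑ l ∈ Finset.range j, z ^ l * y ^ (j - 1 - l) := fun z hz j =>
    Finset.sum_nonneg fun l _ => mul_nonneg (pow_nonneg hz.1 _) (pow_nonneg hy0.le _)
  have hSle : ∀ z ∈ Ico 0 y, ∀ j : ℕ,
      ∑ l ∈ Finset.range j, z ^ l * y ^ (j - 1 - l) ≤ (j:ℝ) * y ^ (j - 1) := by
    intro z hz j
    rw [← geom_sum₂_self]
    refine Finset.sum_le_sum fun l _ => ?_
    exact mul_le_mul_of_nonneg_right (pow_le_pow_left₀ hz.1 hz.2.le _) (pow_nonneg hy0.le _)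
  have hfin : ∀ s : Finset ℕ, ∑ j ∈ s, (j:ℝ) * c j * y ^ (j - 1) ≤ L := by
    intro s
    have hcont : Continuous (fun z : ℝ =>
        ∑ j ∈ s, c j * ∑ l ∈ Finset.range j, z ^ l * y ^ (j - 1 - l)) := by fun_prop
    have h1 := (hcont.tendsto y).mono_left (nhdsWithin_le_nhds (s := Iio y))
    have h2 : ∑ j ∈ s, c j * ∑ l ∈ Finset.range j, y ^ l * y ^ (j - 1 - l) ≤ L := by
      refine le_of_tendsto_of_tendsto h1 hlim ?_
      filter_upwards [hev] with z hz
      exact sum_le_hasSum s (fun j _ => mul_nonneg (hc j) (hSnn z hz j)) (hS z hz)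
    refine le_trans (le_of_eq ?_) h2
    refine Finset.sum_congr rfl fun j _ => ?_
    rw [geom_sum₂_self]; ring
  have hsum : Summable (fun j : ℕ => (j:ℝ) * c j * y ^ (j - 1)) :=
    summable_of_sum_le (fun j => mul_nonneg (mul_nonneg (Nat.cast_nonneg _) (hc j))
      (pow_nonneg hy0.le _)) hfin
  have hle : ∑' j : ℕ, (j:ℝ) * c j * y ^ (j - 1) ≤ L := hsum.tsum_le_of_sum_le hfin
  have hge : L ≤ ∑' j : ℕ, (j:ℝ) * c j * y ^ (j - 1) := by
    refine le_of_tendsto hlim ?_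
    filter_upwards [hev] with z hz
    refine hasSum_le (fun j => ?_) (hS z hz) hsum.hasSum
    calc _ ≤ c j * ((j:ℝ) * y ^ (j - 1)) := mul_le_mul_of_nonneg_left (hSle z hz j) (hc j)
      _ = _ := by ring
  rw [le_antisymm hge hle]
  exact hsum.hasSum

/-- divided difference of the power series -/
noncomputable def auxF (a : ℕ → ℝ) (p : ℝ × ℝ) : ℝ :=
  ∑' k, a k * ∑ l ∈ Finset.range k, p.1 ^ l * p.2 ^ (k - 1 - l)

open Set in
lemma auxF_term (a : ℕ → ℝ) (k : ℕ) (p : ℝ × ℝ) (hp : p ∈ Icc (0:ℝ) 1 ×ˢ Icc (0:ℝ) 1) :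
    ‖a k * ∑ l ∈ Finset.range k, p.1 ^ l * p.2 ^ (k - 1 - l)‖ ≤ ‖(k:ℝ) * a k‖ := by
  obtain ⟨⟨h1, h2⟩, h3, h4⟩ := hp
  have hnn : 0 ≤ ∑ l ∈ Finset.range k, p.1 ^ l * p.2 ^ (k - 1 - l) :=
    Finset.sum_nonneg fun l _ => mul_nonneg (pow_nonneg h1 _) (pow_nonneg h3 _)
  have hle : ∑ l ∈ Finset.range k, p.1 ^ l * p.2 ^ (k - 1 - l) ≤ k := by
    calc _ ≤ ∑ l ∈ Finset.range k, (1:ℝ) := Finset.sum_le_sum fun l _ =>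
          mul_le_one₀ (pow_le_one₀ h1 h2) (pow_nonneg h3 _) (pow_le_one₀ h3 h4)
      _ = k := by simp
  rw [norm_mul, norm_mul, mul_comm, Real.norm_of_nonneg hnn,
    Real.norm_of_nonneg (Nat.cast_nonneg k)]
  exact mul_le_mul_of_nonneg_right hle (norm_nonneg _)

open Set in
lemma auxF_cont (a : ℕ → ℝ) (hs : Summable fun k : ℕ => ‖(k:ℝ) * a k‖) :
    ContinuousOn (auxF a) (Icc (0:ℝ) 1 ×ˢ Icc (0:ℝ) 1) := by
  unfold auxF
  exact continuousOn_tsum (fun k => by fun_prop) hs (fun k p hp => auxF_term a k p hp)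

open Set in
lemma auxF_bound (a : ℕ → ℝ) (hs : Summable fun k : ℕ => ‖(k:ℝ) * a k‖)
    (p : ℝ × ℝ) (hp : p ∈ Icc (0:ℝ) 1 ×ˢ Icc (0:ℝ) 1) :
    ‖auxF a p‖ ≤ ∑' k : ℕ, ‖(k:ℝ) * a k‖ :=
  tsum_of_norm_bounded hs.hasSum (fun k => auxF_term a k p hp)

open Set in
lemma auxF_mul (a : ℕ → ℝ) (f : ℝ → ℝ) (hs : Summable fun k : ℕ => ‖(k:ℝ) * a k‖)
    (hf : ∀ x ∈ Icc (0:ℝ) 1, HasSum (fun k : ℕ => a k * x ^ k) (f x))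
    (u v : ℝ) (hu : u ∈ Icc (0:ℝ) 1) (hv : v ∈ Icc (0:ℝ) 1) :
    f u - f v = auxF a (u, v) * (u - v) := by
  have h1 : Summable (fun k : ℕ => a k * ∑ l ∈ Finset.range k, u ^ l * v ^ (k - 1 - l)) :=
    Summable.of_norm_bounded hs (fun k => auxF_term a k (u, v) ⟨hu, hv⟩)
  have h2 := h1.hasSum.mul_right (u - v)
  refine ((hf u hu).sub (hf v hv)).unique ?_
  refine aux_congr h2 (fun k => ?_) rfl
  rw [mul_assoc, geom_sum₂_mul, mul_sub]

open Set in
lemma auxF_diag (a : ℕ → ℝ) (df : ℝ → ℝ)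
    (hdf : ∀ x ∈ Icc (0:ℝ) 1, HasSum (fun k : ℕ => (k : ℝ) * a k * x ^ (k - 1)) (df x))
    (u : ℝ) (hu : u ∈ Icc (0:ℝ) 1) : auxF a (u, u) = df u := by
  rw [← (hdf u hu).tsum_eq]
  unfold auxF
  refine tsum_congr fun k => ?_
  simp only [geom_sum₂_self]; ring

open Set in
/-- linear ODE -/
lemma aux_ode (D G : ℝ → ℝ) (hG : Continuous G)
    (hD : ∀ t, 0 ≤ t → HasDerivAt D (G t * D t) t) (t : ℝ) (ht : 0 ≤ t) :
    D t = D 0 * Real.exp (∫ τ in (0:ℝ)..t, G τ) := by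
  have hI : ∀ s, HasDerivAt (fun s => ∫ τ in (0:ℝ)..s, G τ) (G s) s := fun s =>
    intervalIntegral.integral_hasDerivAt_right (hG.intervalIntegrable _ _)
      hG.aestronglyMeasurable.stronglyMeasurableAtFilter hG.continuousAt
  have hE : ∀ s, 0 ≤ s → HasDerivAt (fun s => D s * Real.exp (-∫ τ in (0:ℝ)..s, G τ)) 0 s := by
    intro s hs
    have := (hD s hs).mul (hI s).neg.exp
    refine this.congr_deriv ?_
    simp only [Pi.neg_apply]
    ring
  have := constant_of_has_deriv_right_zero (a := 0) (b := t)
    (fun s hs => (hE s hs.1).continuousAt.continuousWithinAt)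
    (fun s hs => (hE s hs.1).hasDerivWithinAt) t ⟨ht, le_rfl⟩
  simp only [intervalIntegral.integral_same, neg_zero, Real.exp_zero, mul_one] at this
  rw [← this, mul_assoc, ← Real.exp_add]; simp

open Filter Set in
lemma aux_deriv_s4
    (a : ℕ → ℝ) (f : ℝ → ℝ) (P : ℝ → ℕ → ℝ) (Φ : ℝ → ℝ → ℝ)
    (hs : Summable fun k : ℕ => ‖(k:ℝ) * a k‖)
    (hf : ∀ x ∈ Set.Icc (0:ℝ) 1, HasSum (fun k : ℕ => a k * x ^ k) (f x))
    (hPnn : ∀ t : ℝ, 0 ≤ t → ∀ j : ℕ, 0 ≤ P t j)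
    (hPsum : ∀ t : ℝ, 0 ≤ t → HasSum (fun j : ℕ => P t j) 1)
    (hΦ : ∀ t : ℝ, 0 ≤ t → ∀ x ∈ Set.Icc (0:ℝ) 1, HasSum (fun j : ℕ => P t j * x ^ j) (Φ t x))
    (hΦ0 : ∀ x ∈ Set.Icc (0:ℝ) 1, Φ 0 x = x)
    (hKol : ∀ x ∈ Set.Icc (0:ℝ) 1, ∀ t : ℝ, 0 ≤ t → HasDerivAt (fun s => Φ s x) (f (Φ t x)) t)
    (df : ℝ → ℝ)
    (hdf : ∀ x ∈ Set.Icc (0:ℝ) 1, HasSum (fun k : ℕ => (k : ℝ) * a k * x ^ (k - 1)) (df x))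
    (t : ℝ) (ht : 0 ≤ t) (y : ℝ) (hy0 : 0 < y) (hy1 : y ≤ 1) :
    IntervalIntegrable (fun τ => df (Φ τ y)) MeasureTheory.volume 0 t ∧
    HasDerivWithinAt (Φ t) (Real.exp (∫ τ in (0:ℝ)..t, df (Φ τ y))) (Iio y) y := by
  have hy : y ∈ Icc (0:ℝ) 1 := ⟨hy0.le, hy1⟩
  have hterm : ∀ s, 0 ≤ s → ∀ j : ℕ, ∀ x ∈ Icc (0:ℝ) 1, P s j * x ^ j ≤ P s j :=
    fun s hs j x hx => mul_le_of_le_one_right (hPnn s hs j) (pow_le_one₀ hx.1 hx.2)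
  have hrange : ∀ s, 0 ≤ s → ∀ x ∈ Icc (0:ℝ) 1, Φ s x ∈ Icc (0:ℝ) 1 := by
    intro s hs x hx
    exact ⟨(hΦ s hs x hx).nonneg (fun j => mul_nonneg (hPnn s hs j) (pow_nonneg hx.1 _)),
      hasSum_le (fun j => hterm s hs j x hx) (hΦ s hs x hx) (hPsum s hs)⟩
  have hcontx : ∀ s, 0 ≤ s → ContinuousOn (Φ s) (Icc 0 1) := by
    intro s hs
    have : ContinuousOn (fun x => ∑' j, P s j * x ^ j) (Icc (0:ℝ) 1) := by
      refine continuousOn_tsum (fun k => by fun_prop) (hPsum s hs).summable (fun j x hx => ?_)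
      rw [Real.norm_of_nonneg (mul_nonneg (hPnn s hs j) (pow_nonneg hx.1 _))]
      exact hterm s hs j x hx
    exact this.congr fun x hx => (hΦ s hs x hx).tsum_eq.symm
  have hcontt : ∀ x ∈ Icc (0:ℝ) 1, Continuous (fun s => Φ (max s 0) x) := by
    intro x hx
    have h1 : ContinuousOn (fun s => Φ s x) (Ici 0) := fun s hs =>
      (hKol x hx s hs).continuousAt.continuousWithinAt
    exact h1.comp_continuous (by fun_prop) (fun s => le_max_right s 0)
  set G : ℝ → ℝ → ℝ := fun z s => auxF a (Φ (max s 0) z, Φ (max s 0) y) with hGdef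
  have hmem : ∀ z ∈ Icc (0:ℝ) 1, ∀ s,
      (Φ (max s 0) z, Φ (max s 0) y) ∈ Icc (0:ℝ) 1 ×ˢ Icc (0:ℝ) 1 := fun z hz s =>
    ⟨hrange _ (le_max_right _ _) z hz, hrange _ (le_max_right _ _) y hy⟩
  have hGc : ∀ z ∈ Icc (0:ℝ) 1, Continuous (G z) := fun z hz =>
    (auxF_cont a hs).comp_continuous ((hcontt z hz).prodMk (hcontt y hy)) (hmem z hz)
  have hGy : ∀ s, 0 ≤ s → G y s = df (Φ s y) := by
    intro s hs
    simp only [hGdef, max_eq_left hs]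
    exact auxF_diag a df hdf _ (hrange s hs y hy)
  have hslope : ∀ z ∈ Ico 0 y, slope (Φ t) y z = Real.exp (∫ τ in (0:ℝ)..t, G z τ) := by
    intro z hz
    have hz1 : z ∈ Icc (0:ℝ) 1 := ⟨hz.1, hz.2.le.trans hy1⟩
    have h := aux_ode (fun s => Φ s z - Φ s y) (G z) (hGc z hz1) (fun s hs0 => by
      have := (hKol z hz1 s hs0).sub (hKol y hy s hs0)
      rw [auxF_mul a f hs hf _ _ (hrange s hs0 z hz1) (hrange s hs0 y hy)] at this
      simp only [hGdef, max_eq_left hs0]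
      exact this) t ht
    simp only [hΦ0 z hz1, hΦ0 y hy] at h
    rw [slope_def_field, h]
    have hne : z - y ≠ 0 := sub_ne_zero.2 hz.2.ne
    field_simp
  have hev : ∀ᶠ z in 𝓝[<] y, z ∈ Ico 0 y := Ico_mem_nhdsLT hy0
  have hev1 : ∀ᶠ z in 𝓝[<] y, z ∈ Icc (0:ℝ) 1 :=
    hev.mono fun z hz => ⟨hz.1, hz.2.le.trans hy1⟩
  have hlimI : Tendsto (fun z => ∫ τ in (0:ℝ)..t, G z τ) (𝓝[<] y)
      (𝓝 (∫ τ in (0:ℝ)..t, G y τ)) := by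
    refine intervalIntegral.tendsto_integral_filter_of_dominated_convergence
      (fun _ => ∑' k : ℕ, ‖(k:ℝ) * a k‖) ?_ ?_ ?_ ?_
    · filter_upwards [hev1] with z hz
      exact (hGc z hz).aestronglyMeasurable
    · filter_upwards [hev1] with z hz
      exact MeasureTheory.ae_of_all _ fun s _ => auxF_bound a hs _ (hmem z hz s)
    · exact intervalIntegrable_const
    · refine MeasureTheory.ae_of_all _ fun s _ => ?_
      have h1 : ContinuousOn (fun z => G z s) (Icc 0 1) :=
        (auxF_cont a hs).comp ((hcontx _ (le_max_right s 0)).prodMk continuousOn_const)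
          (fun z hz => hmem z hz s)
      have h2 : Tendsto (fun z => G z s) (𝓝[Icc 0 1] y) (𝓝 (G y s)) := h1 y hy
      exact h2.mono_left (le_inf inf_le_left (le_principal_iff.2 hev1))
  have heq : EqOn (G y) (fun τ => df (Φ τ y)) (uIcc 0 t) := by
    intro s hs
    rw [uIcc_of_le ht] at hs
    exact hGy s hs.1
  constructor
  · exact IntervalIntegrable.congr (heq.mono uIoc_subset_uIcc)
      ((hGc y hy).intervalIntegrable 0 t)
  · rw [hasDerivWithinAt_iff_tendsto_slope' (by simp), ← intervalIntegral.integral_congr heq]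
    refine (Real.continuous_exp.continuousAt.tendsto.comp hlimI).congr' ?_
    filter_upwards [hev] with z hz
    exact (hslope z hz).symm

theorem stmt_4
    (a : ℕ → ℝ) (f : ℝ → ℝ) (P : ℝ → ℕ → ℝ) (Φ : ℝ → ℝ → ℝ)
    (ha : ∀ k : ℕ, k ≠ 1 → 0 ≤ a k)
    (ha0 : 0 < a 0)
    (ha1 : HasSum (fun k : ℕ => if k = 1 then (0:ℝ) else a k) (-(a 1)))
    (ha01 : a 0 < -(a 1))
    (hf : ∀ x ∈ Set.Icc (0:ℝ) 1, HasSum (fun k : ℕ => a k * x ^ k) (f x))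
    (hPnn : ∀ t : ℝ, 0 ≤ t → ∀ j : ℕ, 0 ≤ P t j)
    (hPsum : ∀ t : ℝ, 0 ≤ t → HasSum (fun j : ℕ => P t j) 1)
    (hΦ : ∀ t : ℝ, 0 ≤ t → ∀ x ∈ Set.Icc (0:ℝ) 1, HasSum (fun j : ℕ => P t j * x ^ j) (Φ t x))
    (hΦ0 : ∀ x ∈ Set.Icc (0:ℝ) 1, Φ 0 x = x)
    (hKol : ∀ x ∈ Set.Icc (0:ℝ) 1, ∀ t : ℝ, 0 ≤ t → HasDerivAt (fun s => Φ s x) (f (Φ t x)) t)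
    (m : ℝ)
    (hm : HasSum (fun k : ℕ => (k : ℝ) * a k) m)
    (q fq β : ℝ)
    (hq : q = sInf {x : ℝ | x ∈ Set.Icc (0:ℝ) 1 ∧ f x = 0})
    (hfq : HasSum (fun k : ℕ => (k : ℝ) * a k * q ^ (k - 1)) fq)
    (hβ : β = Real.exp fq)
    (Pi : ℕ → ℝ → ℕ → ℝ)
    (hPi : ∀ i : ℕ, 1 ≤ i → ∀ t : ℝ, 0 ≤ t → ∀ x ∈ Set.Icc (0:ℝ) 1,
      HasSum (fun j : ℕ => Pi i t j * x ^ j) ((Φ t x) ^ i))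
    (hPinn : ∀ i : ℕ, 1 ≤ i → ∀ t : ℝ, 0 ≤ t → ∀ j : ℕ, 0 ≤ Pi i t j)
    (df : ℝ → ℝ)
    (hdf : ∀ x ∈ Set.Icc (0:ℝ) 1, HasSum (fun k : ℕ => (k : ℝ) * a k * x ^ (k - 1)) (df x))
    :
    ∀ i : ℕ, 1 ≤ i → ∀ t : ℝ, 0 ≤ t → ∀ x ∈ Set.Icc (0:ℝ) 1,
      HasSum
        (fun j : ℕ => (j : ℝ) * q ^ ((j : ℤ) - (i : ℤ)) * Pi i t j / ((i : ℝ) * β ^ t) * x ^ j)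
        (x * (Φ t (q * x) / q) ^ (i - 1) *
          Real.exp (∫ τ in (0:ℝ)..t, (df (Φ τ (q * x)) - fq))) := by
  intro i hi t ht x hx
  have hs : Summable fun k : ℕ => ‖(k:ℝ) * a k‖ := hm.summable.norm
  -- q is positive
  have hf1 : f 1 = 0 := by
    have h1 := hf 1 (by simp)
    have h2 := ha1.add (hasSum_ite_eq 1 (a 1))
    refine h1.unique ?_
    convert h2 using 1
    · ext k
      by_cases hk : k = 1 <;> simp [hk]
    · simp
  have hfc : ContinuousOn f (Set.Icc 0 1) := by
    have h1 := (hf 1 (by simp)).summable.norm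
    have : ContinuousOn (fun x => ∑' k, a k * x ^ k) (Set.Icc (0:ℝ) 1) := by
      refine continuousOn_tsum (fun k => by fun_prop) h1 (fun k z hz => ?_)
      rw [norm_mul, norm_mul]
      refine mul_le_mul_of_nonneg_left ?_ (norm_nonneg _)
      rw [one_pow, norm_one, Real.norm_of_nonneg (pow_nonneg hz.1 _)]
      exact pow_le_one₀ hz.1 hz.2
    exact this.congr fun z hz => (hf z hz).tsum_eq.symm
  have hcl : IsClosed {x : ℝ | x ∈ Set.Icc (0:ℝ) 1 ∧ f x = 0} :=
    hfc.preimage_isClosed_of_isClosed isClosed_Icc (isClosed_singleton (x := (0:ℝ)))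
  have hqS : q ∈ {x : ℝ | x ∈ Set.Icc (0:ℝ) 1 ∧ f x = 0} := by
    rw [hq]
    exact hcl.csInf_mem ⟨1, by simp, hf1⟩ ⟨0, fun z hz => hz.1.1⟩
  have hq0 : 0 < q := by
    refine lt_of_le_of_ne hqS.1.1 fun h => ?_
    have h1 := hqS.2
    rw [← h] at h1
    have h2 := (hf 0 (by simp)).unique (hasSum_single 0 (fun k hk => by simp [hk]))
    simp at h2
    linarith
  have hq1 : q ≤ 1 := hqS.1.2
  rcases hx.1.eq_or_lt with hx0 | hx0
  · subst hx0
    simp only [zero_mul]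
    convert hasSum_zero using 1
    ext j
    rcases j with _ | j <;> simp
  have hy0 : 0 < q * x := mul_pos hq0 hx0
  have hy1 : q * x ≤ 1 := mul_le_one₀ hq1 hx.1 hx.2
  obtain ⟨hint, hder⟩ := aux_deriv_s4 a f P Φ hs hf hPnn hPsum hΦ hΦ0 hKol df hdf t ht _ hy0 hy1
  have hser := aux_series (Pi i t) (fun z => Φ t z ^ i) (q * x) _ hy0 hy1 (hPinn i hi t ht)
    (hPi i hi t ht) (hder.pow i)
  have hfin := hser.mul_right (q * x / (q ^ i * (i * β ^ t)))
  have hβt : β ^ t = Real.exp (fq * t) := by rw [hβ, Real.exp_mul]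
  have hi0 : (i:ℝ) ≠ 0 := by exact_mod_cast (by omega : i ≠ 0)
  have hb : β ^ t ≠ 0 := by rw [hβt]; exact Real.exp_ne_zero _
  refine aux_congr hfin (fun j => ?_) ?_
  · rcases j with _ | j
    · simp
    · rw [zpow_sub₀ hq0.ne', zpow_natCast, zpow_natCast, Nat.add_sub_cancel, mul_pow]
      field_simp
      ring
  · rw [intervalIntegral.integral_sub hint intervalIntegrable_const,
      intervalIntegral.integral_const, Real.exp_sub, smul_eq_mul, sub_zero, mul_comm t fq, ← hβt]
    obtain ⟨n, rfl⟩ : ∃ n, i = n + 1 := ⟨i - 1, by omega⟩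
    rw [Nat.add_sub_cancel, div_pow]
    field_simp
    ring
end

section
/- For every i ≥ 1 and t ≥ 0, the mean of the Markov Q-process started from i particles satisfies: Σ_{j≥1} j·Q_{ij}(t) = (i−1)β^t + b·t + 1 in the critical case, and Σ_{j≥1} j·Q_{ij}(t) = (i−1)β^t + 1 + γ(1−β^t) in the noncritical case. -/
open scoped Topology

open Filter Set

lemma hasSum_cast {f g : ℕ → ℝ} {a b : ℝ} (h : HasSum f a) (hfg : ∀ j, g j = f j) (hab : b = a) :
    HasSum g b := by
  rw [hab, (funext hfg : g = f)]; exact h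

/-- second order remainder coefficients -/
noncomputable def sPoly (q : ℝ) : ℕ → ℝ → ℝ
  | 0, _ => 0
  | (k+1), u => (q - u) * sPoly q k u + k * q ^ (k-1)

/-- first order difference coefficients -/
noncomputable def dPoly (q : ℝ) : ℕ → ℝ → ℝ
  | 0, _ => 0
  | (k+1), u => (q - u) * dPoly q k u + q ^ k

lemma qpow (q : ℝ) (k : ℕ) : (k:ℝ) * q ^ k = k * q ^ (k-1) * q := by
  cases k with
  | zero => simp
  | succ n => simp [pow_succ]; ring

lemma sPoly_eq (q u : ℝ) (k : ℕ) :
    (q - u) ^ k = q ^ k - k * q ^ (k-1) * u + sPoly q k u * u ^ 2 := by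
  induction k with
  | zero => simp [sPoly]
  | succ n ih =>
    rw [pow_succ, ih, sPoly]
    have := qpow q n
    push_cast
    rw [pow_succ]
    linear_combination (u) * this

lemma dPoly_eq (q u : ℝ) (k : ℕ) : (q - u) ^ k = q ^ k - dPoly q k u * u := by
  induction k with
  | zero => simp [dPoly]
  | succ n ih =>
    rw [pow_succ, ih, dPoly]
    ring

lemma dPoly_zero (q : ℝ) (k : ℕ) : dPoly q k 0 = k * q ^ (k-1) := by
  induction k with
  | zero => simp [dPoly]
  | succ n ih =>
    rw [dPoly, ih]
    have := qpow q n
    push_cast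
    linear_combination -this

lemma sPoly_zero (q : ℝ) (k : ℕ) : 2 * q * sPoly q k 0 = k * (k - 1) * q ^ (k-1) := by
  induction k with
  | zero => simp [sPoly]
  | succ n ih =>
    rw [sPoly]
    have := qpow q n
    push_cast
    linear_combination q * ih - ((n:ℝ) + 1) * this

lemma sPoly_nonneg (q u : ℝ) (hq : 0 ≤ q) (hu : 0 ≤ q - u) (k : ℕ) : 0 ≤ sPoly q k u := by
  induction k with
  | zero => simp [sPoly]
  | succ n ih => rw [sPoly]; positivity

lemma dPoly_nonneg (q u : ℝ) (hq : 0 ≤ q) (hu : 0 ≤ q - u) (k : ℕ) : 0 ≤ dPoly q k u := by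
  induction k with
  | zero => simp [dPoly]
  | succ n ih => rw [dPoly]; positivity

lemma sPoly_pos (q u : ℝ) (hq : 0 < q) (hu : 0 ≤ q - u) (k : ℕ) (hk : 2 ≤ k) :
    0 < sPoly q k u := by
  obtain ⟨n, rfl⟩ : ∃ n, k = n + 1 := ⟨k - 1, by omega⟩
  rw [sPoly]
  have h1 := sPoly_nonneg q u hq.le hu n
  have : (0:ℝ) < n := by exact_mod_cast (by omega : 0 < n)
  positivity

lemma sPoly_le (q u : ℝ) (hq : 0 ≤ q) (hu0 : 0 ≤ u) (hu : 0 ≤ q - u) (k : ℕ) :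
    sPoly q k u ≤ sPoly q k 0 := by
  induction k with
  | zero => simp [sPoly]
  | succ n ih =>
    rw [sPoly, sPoly]
    have := sPoly_nonneg q u hq hu n
    have h2 : (q - u) * sPoly q n u ≤ (q - 0) * sPoly q n 0 :=
      mul_le_mul (by linarith) ih this (by linarith)
    linarith

lemma dPoly_le (q u : ℝ) (hq : 0 ≤ q) (hu0 : 0 ≤ u) (hu : 0 ≤ q - u) (k : ℕ) :
    dPoly q k u ≤ dPoly q k 0 := by
  induction k with
  | zero => simp [dPoly]
  | succ n ih =>
    rw [dPoly, dPoly]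
    have := dPoly_nonneg q u hq hu n
    have h2 : (q - u) * dPoly q n u ≤ (q - 0) * dPoly q n 0 :=
      mul_le_mul (by linarith) ih this (by linarith)
    linarith

lemma sPoly_cont (q : ℝ) (k : ℕ) : Continuous (sPoly q k) := by
  induction k with
  | zero => exact continuous_const
  | succ n ih =>
    have : sPoly q (n+1) = fun u => (q - u) * sPoly q n u + n * q ^ (n-1) := by
      funext u; rw [sPoly]
    rw [this]; fun_prop

lemma dPoly_cont (q : ℝ) (k : ℕ) : Continuous (dPoly q k) := by
  induction k with
  | zero => exact continuous_const
  | succ n ih =>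
    have : dPoly q (n+1) = fun u => (q - u) * dPoly q n u + q ^ n := by
      funext u; rw [dPoly]
    rw [this]; fun_prop

lemma fatou_hasSum (l : Filter ℝ) [l.NeBot] [l.IsCountablyGenerated] (g : ℝ → ℕ → ℝ) (L : ℕ → ℝ)
    (S : ℝ → ℝ) (S0 : ℝ)
    (h0 : ∀ᶠ e in l, ∀ j, 0 ≤ g e j) (h1 : ∀ᶠ e in l, ∀ j, g e j ≤ L j)
    (h2 : ∀ j, Tendsto (fun e => g e j) l (𝓝 (L j)))
    (h3 : ∀ᶠ e in l, HasSum (g e) (S e)) (h4 : Tendsto S l (𝓝 S0)) : HasSum L S0 := by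
  have hL : ∀ j, 0 ≤ L j := fun j => ge_of_tendsto (h2 j) (h0.mono fun e he => he j)
  have hs : Summable L := by
    refine summable_of_sum_le (c := S0) hL fun F => ?_
    refine le_of_tendsto_of_tendsto (tendsto_finsetSum F fun j _ => h2 j) h4 ?_
    filter_upwards [h0, h3] with e he h
    exact sum_le_hasSum F (fun j _ => he j) h
  have h5 : Tendsto (fun e => ∑' j, g e j) l (𝓝 (∑' j, L j)) := by
    refine tendsto_tsum_of_dominated_convergence (bound := L) hs h2 ?_
    filter_upwards [h0, h1] with e ha hb j
    rw [Real.norm_eq_abs, abs_of_nonneg (ha j)]; exact hb j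
  have h6 : Tendsto (fun e => ∑' j, g e j) l (𝓝 S0) := by
    refine h4.congr' ?_
    filter_upwards [h3] with e h using h.tsum_eq.symm
  have := tendsto_nhds_unique h5 h6
  rw [← this]; exact hs.hasSum

lemma le_of_deriv_nonneg' (g g' : ℝ → ℝ) (t : ℝ) (ht : 0 ≤ t)
    (h : ∀ s ∈ Icc 0 t, HasDerivAt g (g' s) s) (h0 : ∀ s ∈ Icc 0 t, 0 ≤ g' s) : g 0 ≤ g t := by
  have : MonotoneOn g (Icc 0 t) := by
    refine monotoneOn_of_deriv_nonneg (convex_Icc 0 t)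
      (fun s hs => (h s hs).continuousAt.continuousWithinAt)
      (fun s hs => (h s (interior_subset hs)).differentiableAt.differentiableWithinAt)
      (fun s hs => ?_)
    rw [(h s (interior_subset hs)).deriv]; exact h0 s (interior_subset hs)
  exact this ⟨le_rfl, ht⟩ ⟨ht, le_rfl⟩ ht

lemma ode_bounds (lam t l c : ℝ) (ht : 0 ≤ t) (E u ρ : ℝ → ℝ)
    (hE : ∀ s, HasDerivAt E (Real.exp (lam * s)) s) (hE0 : E 0 = 0)
    (hu : ∀ s ∈ Icc 0 t, 0 < u s)
    (hd : ∀ s ∈ Icc 0 t, HasDerivAt u (lam * u s - ρ s * u s ^ 2) s)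
    (hl : ∀ s ∈ Icc 0 t, l ≤ ρ s) (hc : ∀ s ∈ Icc 0 t, ρ s ≤ c) :
    l * E t ≤ Real.exp (lam * t) / u t - 1 / u 0 ∧
    Real.exp (lam * t) / u t - 1 / u 0 ≤ c * E t := by
  have hw : ∀ s ∈ Icc 0 t, HasDerivAt (fun s => Real.exp (lam * s) / u s)
      (Real.exp (lam * s) * ρ s) s := by
    intro s hs
    have h1 : HasDerivAt (fun s => Real.exp (lam * s)) (Real.exp (lam * s) * lam) s := by
      have := ((hasDerivAt_id s).const_mul lam).exp
      simpa using this
    have h2 := h1.div (hd s hs) (hu s hs).ne'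
    refine HasDerivAt.congr_deriv (f := fun s => Real.exp (lam * s) / u s) h2 ?_
    have := (hu s hs).ne'
    field_simp
    ring
  constructor
  · have := le_of_deriv_nonneg' (fun s => Real.exp (lam * s) / u s - l * E s)
      (fun s => Real.exp (lam * s) * ρ s - l * Real.exp (lam * s)) t ht
      (fun s hs => (hw s hs).sub ((hE s).const_mul l)) (fun s hs => by
        have := hl s hs
        have h3 := Real.exp_pos (lam * s)
        nlinarith)
    simp [hE0] at this ⊢
    linarith
  · have := le_of_deriv_nonneg' (fun s => c * E s - Real.exp (lam * s) / u s)
      (fun s => c * Real.exp (lam * s) - Real.exp (lam * s) * ρ s) t ht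
      (fun s hs => ((hE s).const_mul c).sub (hw s hs)) (fun s hs => by
        have := hc s hs
        have h3 := Real.exp_pos (lam * s)
        nlinarith)
    simp [hE0] at this ⊢
    linarith

/-- coefficient extraction -/
lemma coeff_extract (q A B : ℝ) (hq : 0 < q) (p : ℕ → ℝ) (hp : ∀ j, 0 ≤ p j) (G : ℝ → ℝ)
    (G0 : ℝ) (hG0 : HasSum (fun j => p j * q ^ j) G0)
    (hG : ∀ e ∈ Icc 0 q, HasSum (fun j => p j * (q - e) ^ j) (G e))
    (h1 : Tendsto (fun e => (G0 - G e) / e) (𝓝[>] 0) (𝓝 A))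
    (h2 : Tendsto (fun e => (G e - G0 + e * A) / e ^ 2) (𝓝[>] 0) (𝓝 B)) :
    HasSum (fun j => p j * dPoly q j 0) A ∧ HasSum (fun j => p j * sPoly q j 0) B := by
  have hev : ∀ᶠ e in 𝓝[>] (0:ℝ), e ∈ Ioo 0 q := Ioo_mem_nhdsGT hq
  have hA : HasSum (fun j => p j * dPoly q j 0) A := by
    refine fatou_hasSum (𝓝[>] 0) (fun e j => p j * dPoly q j e) _ _ _ ?_ ?_ ?_ ?_ h1
    · filter_upwards [hev] with e he j
      exact mul_nonneg (hp j) (dPoly_nonneg q e hq.le (by linarith [he.2]) j)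
    · filter_upwards [hev] with e he j
      exact mul_le_mul_of_nonneg_left (dPoly_le q e hq.le he.1.le (by linarith [he.2]) j) (hp j)
    · intro j
      exact (((dPoly_cont q j).tendsto 0).mono_left nhdsWithin_le_nhds).const_mul _
    · filter_upwards [hev] with e he
      have := (hG0.sub (hG e ⟨he.1.le, he.2.le⟩)).div_const e
      refine hasSum_cast this (fun j => ?_) rfl
      rw [dPoly_eq]
      have := he.1.ne'
      field_simp
      ring
  refine ⟨hA, ?_⟩
  refine fatou_hasSum (𝓝[>] 0) (fun e j => p j * sPoly q j e) _ _ _ ?_ ?_ ?_ ?_ h2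
  · filter_upwards [hev] with e he j
    exact mul_nonneg (hp j) (sPoly_nonneg q e hq.le (by linarith [he.2]) j)
  · filter_upwards [hev] with e he j
    exact mul_le_mul_of_nonneg_left (sPoly_le q e hq.le he.1.le (by linarith [he.2]) j) (hp j)
  · intro j
    exact (((sPoly_cont q j).tendsto 0).mono_left nhdsWithin_le_nhds).const_mul _
  · filter_upwards [hev] with e he
    have := (((hG e ⟨he.1.le, he.2.le⟩).sub hG0).add (hA.mul_left e)).div_const (e^2)
    refine hasSum_cast this (fun j => ?_) rfl
    rw [sPoly_eq, dPoly_zero]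
    have := he.1.ne'
    field_simp
    ring

lemma dPoly_le_nat (x u : ℝ) (hx : x ∈ Icc (0:ℝ) 1) (hu : x - u ∈ Icc (0:ℝ) 1) (k : ℕ) :
    dPoly x k u ≤ k := by
  induction k with
  | zero => simp [dPoly]
  | succ n ih =>
    rw [dPoly]
    push_cast
    have h1 := dPoly_nonneg x u hx.1 hu.1 n
    have h2 : x ^ n ≤ 1 := pow_le_one₀ hx.1 hx.2
    have h3 : (x - u) * dPoly x n u ≤ 1 * dPoly x n u := mul_le_mul_of_nonneg_right hu.2 h1
    linarith

lemma f_lip (a : ℕ → ℝ) (f : ℝ → ℝ)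
    (hf : ∀ x ∈ Icc (0:ℝ) 1, HasSum (fun k : ℕ => a k * x ^ k) (f x))
    (hm : Summable (fun k : ℕ => (k : ℝ) * a k)) :
    ∃ K : ℝ, 0 ≤ K ∧ ∀ x ∈ Icc (0:ℝ) 1, ∀ y ∈ Icc (0:ℝ) 1, |f y - f x| ≤ K * |y - x| := by
  refine ⟨∑' k : ℕ, |(k : ℝ) * a k|, tsum_nonneg fun k => abs_nonneg _, fun x hx y hy => ?_⟩
  have h1 := (hf y hy).sub (hf x hx)
  have h2 := hm.abs.hasSum.mul_right |y - x|
  have key : ∀ k : ℕ, |a k * y ^ k - a k * x ^ k| ≤ |(k : ℝ) * a k| * |y - x| := by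
    intro k
    have e := dPoly_eq x (x - y) k
    have e2 := dPoly_nonneg x (x - y) hx.1 (by simpa using hy.1) k
    have e3 := dPoly_le_nat x (x - y) hx (by simpa using hy) k
    have e4 : a k * y ^ k - a k * x ^ k = (dPoly x k (x - y) * a k) * (y - x) := by
      rw [sub_sub_cancel] at e; rw [e]; ring
    rw [e4, abs_mul, abs_mul, abs_mul, abs_of_nonneg e2, Nat.abs_cast]
    gcongr
  rw [abs_le]
  constructor
  · have := hasSum_le (fun k => (abs_le.mp (key k)).1) h2.neg h1
    exact this
  · exact hasSum_le (fun k => (abs_le.mp (key k)).2) h1 h2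

lemma f_rem (a : ℕ → ℝ) (f : ℝ → ℝ)
    (hf : ∀ x ∈ Icc (0:ℝ) 1, HasSum (fun k : ℕ => a k * x ^ k) (f x))
    (x y d : ℝ) (hx : x ∈ Icc (0:ℝ) 1) (hy : y ∈ Icc (0:ℝ) 1)
    (hd : HasSum (fun k : ℕ => (k : ℝ) * a k * x ^ (k - 1)) d) :
    HasSum (fun k => a k * sPoly x k (x - y) * (x - y) ^ 2) (f y - f x + d * (x - y)) := by
  refine hasSum_cast (((hf y hy).sub (hf x hx)).add (hd.mul_right (x - y))) (fun k => ?_) rfl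
  have := sPoly_eq x (x - y) k
  rw [sub_sub_cancel] at this
  rw [this]; ring

lemma sPoly_coef_nonneg (a : ℕ → ℝ) (ha : ∀ k : ℕ, k ≠ 1 → 0 ≤ a k) (x u : ℝ) (hx : 0 ≤ x)
    (hu : 0 ≤ x - u) (k : ℕ) : 0 ≤ a k * sPoly x k u := by
  by_cases h : k = 1
  · subst h; simp [sPoly]
  · exact mul_nonneg (ha k h) (sPoly_nonneg x u hx hu k)

lemma tangent_lt (a : ℕ → ℝ) (f : ℝ → ℝ) (ha : ∀ k : ℕ, k ≠ 1 → 0 ≤ a k)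
    (ha1 : HasSum (fun k : ℕ => if k = 1 then (0:ℝ) else a k) (-(a 1)))
    (ha01 : a 0 < -(a 1))
    (hf : ∀ x ∈ Icc (0:ℝ) 1, HasSum (fun k : ℕ => a k * x ^ k) (f x))
    (x y d : ℝ) (hx : x ∈ Icc (0:ℝ) 1) (hx0 : 0 < x) (hy : y ∈ Icc (0:ℝ) 1) (hxy : x ≠ y)
    (hd : HasSum (fun k : ℕ => (k : ℝ) * a k * x ^ (k - 1)) d) :
    0 < f y - f x + d * (x - y) := by
  obtain ⟨k, hk, hak⟩ : ∃ k, 2 ≤ k ∧ 0 < a k := by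
    by_contra hcon
    push Not at hcon
    have h0 : HasSum (fun k : ℕ => if k = 1 then (0:ℝ) else a k) (a 0) := by
      have := hasSum_single (f := fun k : ℕ => if k = 1 then (0:ℝ) else a k) 0 (by
        intro k hk
        by_cases h : k = 1
        · simp [h]
        · simp only [h, if_false]
          exact le_antisymm (hcon k (by omega)) (ha k h))
      simpa using this
    have := h0.unique ha1
    linarith
  have hr := f_rem a f hf x y d hx hy hd
  have hn : ∀ k, 0 ≤ a k * sPoly x k (x - y) * (x - y) ^ 2 := fun k =>
    mul_nonneg (sPoly_coef_nonneg a ha x (x - y) hx.1 (by simpa using hy.1) k) (sq_nonneg _)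
  have h1 := le_hasSum hr k (fun j _ => hn j)
  have h2 := sPoly_pos x (x - y) hx0 (by simpa using hy.1) k hk
  have h3 : 0 < (x - y) ^ 2 := by
    have : x - y ≠ 0 := sub_ne_zero.mpr hxy
    positivity
  have : 0 < a k * sPoly x k (x - y) * (x - y) ^ 2 := by positivity
  linarith

lemma Phi_q (f : ℝ → ℝ) (K q t : ℝ) (hK : ∀ x ∈ Icc (0:ℝ) 1, |f x| ≤ K * |x - q|)
    (ht : 0 ≤ t) (v : ℝ → ℝ) (hv0 : v 0 = q)
    (hv : ∀ s ∈ Icc 0 t, v s ∈ Icc (0:ℝ) 1)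
    (hd : ∀ s ∈ Icc 0 t, HasDerivAt v (f (v s)) s) : v t = q := by
  have := le_of_deriv_nonneg' (fun s => -((v s - q) ^ 2 * Real.exp (-(2 * K) * s)))
    (fun s => -((2 * (v s - q) * f (v s)) * Real.exp (-(2 * K) * s)
      + (v s - q) ^ 2 * (Real.exp (-(2 * K) * s) * (-(2 * K))))) t ht
    (fun s hs => by
      have h1 : HasDerivAt (fun s => Real.exp (-(2 * K) * s))
          (Real.exp (-(2 * K) * s) * (-(2 * K))) s := by
        have := ((hasDerivAt_id s).const_mul (-(2 * K))).exp
        simpa using this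
      have h2 : HasDerivAt (fun s => (v s - q) ^ 2) (2 * (v s - q) * f (v s)) s := by
        have := ((hd s hs).sub_const q).pow 2
        refine HasDerivAt.congr_deriv (f := fun s => (v s - q) ^ 2) this ?_
        simp
      exact (h2.mul h1).neg)
    (fun s hs => by
      have h1 := hK (v s) (hv s hs)
      have h2 := Real.exp_pos (-(2 * K) * s)
      have h3 : (v s - q) * f (v s) ≤ K * (v s - q) ^ 2 := by
        calc (v s - q) * f (v s) ≤ |v s - q| * |f (v s)| := by rw [← abs_mul]; exact le_abs_self _
          _ ≤ |v s - q| * (K * |v s - q|) := by gcongr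
          _ = K * (v s - q) ^ 2 := by rw [← sq_abs (v s - q)]; ring
      nlinarith)
  simp only [hv0, sub_self] at this
  have h2 := Real.exp_pos (-(2 * K) * t)
  have h3 : (v t - q) ^ 2 ≤ 0 := by
    by_contra hc
    push Not at hc
    have := mul_pos hc h2
    linarith
  have : v t - q = 0 := by
    have := le_antisymm h3 (sq_nonneg _)
    exact pow_eq_zero_iff (two_ne_zero) |>.mp this
  linarith

lemma u_pos (F : ℝ → ℝ) (K t : ℝ) (ht : 0 ≤ t) (u : ℝ → ℝ) (hu0 : 0 < u 0)
    (hd : ∀ s ∈ Icc 0 t, HasDerivAt u (F s) s)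
    (hF : ∀ s ∈ Icc 0 t, -(K * u s) ≤ F s) : 0 < u t := by
  have := le_of_deriv_nonneg' (fun s => u s * Real.exp (K * s))
    (fun s => F s * Real.exp (K * s) + u s * (Real.exp (K * s) * K)) t ht
    (fun s hs => by
      have h1 : HasDerivAt (fun s => Real.exp (K * s)) (Real.exp (K * s) * K) s := by
        have := ((hasDerivAt_id s).const_mul K).exp
        simpa using this
      exact (hd s hs).mul h1)
    (fun s hs => by
      have h1 := hF s hs
      have h2 := Real.exp_pos (K * s)
      nlinarith)
  simp at this
  have h2 := Real.exp_pos (K * t)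
  by_contra hc
  push Not at hc
  nlinarith

lemma core_T (lam t c q : ℝ) (hq : 0 < q) (ht : 0 ≤ t) (E : ℝ → ℝ) (U : ℝ → ℝ → ℝ) (R : ℝ → ℝ)
    (hE : ∀ s, HasDerivAt E (Real.exp (lam * s)) s) (hE0 : E 0 = 0)
    (hU0 : ∀ e ∈ Ioo 0 q, U e 0 = e)
    (hU : ∀ e ∈ Ioo 0 q, ∀ s ∈ Icc 0 t, 0 < U e s ∧ U e s ≤ q)
    (hd : ∀ e ∈ Ioo 0 q, ∀ s ∈ Icc 0 t, HasDerivAt (U e) (lam * U e s - R (U e s)) s)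
    (hR0 : ∀ v ∈ Ioc 0 q, 0 ≤ R v / v ^ 2) (hRc : ∀ v ∈ Ioc 0 q, R v / v ^ 2 ≤ c)
    (hR : Tendsto (fun v => R v / v ^ 2) (𝓝[>] 0) (𝓝 c)) :
    Tendsto (fun e => Real.exp (lam * t) / U e t - 1 / e) (𝓝[>] 0) (𝓝 (c * E t)) := by
  have hev : ∀ᶠ e in 𝓝[>] (0:ℝ), e ∈ Ioo 0 q := Ioo_mem_nhdsGT hq
  have hEn : ∀ s, 0 ≤ s → 0 ≤ E s := by
    intro s hs
    have := le_of_deriv_nonneg' E (fun s => Real.exp (lam * s)) s hs (fun r _ => hE r)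
      (fun r _ => (Real.exp_pos _).le)
    rwa [hE0] at this
  have hd' : ∀ e ∈ Ioo 0 q, ∀ s ∈ Icc 0 t,
      HasDerivAt (U e) (lam * U e s - R (U e s) / U e s ^ 2 * U e s ^ 2) s := by
    intro e he s hs
    have := (hU e he s hs).1.ne'
    rw [div_mul_cancel₀ _ (pow_ne_zero 2 this)]
    exact hd e he s hs
  have hbd : ∀ e ∈ Ioo 0 q, ∀ s ∈ Icc 0 t, U e s ≤ Real.exp (|lam| * t) * e := by
    intro e he s hs
    have hsub : ∀ r ∈ Icc 0 s, r ∈ Icc 0 t := fun r hr => ⟨hr.1, hr.2.trans hs.2⟩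
    have := (ode_bounds lam s 0 c hs.1 E (U e) (fun r => R (U e r) / U e r ^ 2) hE hE0
      (fun r hr => (hU e he r (hsub r hr)).1) (fun r hr => hd' e he r (hsub r hr))
      (fun r hr => hR0 _ (hU e he r (hsub r hr))) (fun r hr => hRc _ (hU e he r (hsub r hr)))).1
    rw [hU0 e he, zero_mul, sub_nonneg, div_le_div_iff₀ he.1 (hU e he s hs).1, one_mul] at this
    refine this.trans ?_
    have h1 : lam * s ≤ |lam| * t :=
      mul_le_mul (le_abs_self _) hs.2 hs.1 (abs_nonneg _)
    exact mul_le_mul_of_nonneg_right (Real.exp_le_exp.mpr h1) he.1.le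
  have hup : ∀ᶠ e in 𝓝[>] (0:ℝ), Real.exp (lam * t) / U e t - 1 / e ≤ c * E t := by
    filter_upwards [hev] with e he
    have := (ode_bounds lam t 0 c ht E (U e) (fun r => R (U e r) / U e r ^ 2) hE hE0
      (fun r hr => (hU e he r hr).1) (fun r hr => hd' e he r hr)
      (fun r hr => hR0 _ (hU e he r hr)) (fun r hr => hRc _ (hU e he r hr))).2
    rwa [hU0 e he] at this
  have hlow : ∀ l < c, ∀ᶠ e in 𝓝[>] (0:ℝ), l * E t ≤ Real.exp (lam * t) / U e t - 1 / e := by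
    intro l hl
    have h1 : ∀ᶠ v in 𝓝[>] (0:ℝ), l < R v / v ^ 2 := hR.eventually (lt_mem_nhds hl)
    obtain ⟨η, hη, h2⟩ := mem_nhdsGT_iff_exists_Ioo_subset.mp h1
    have hη' : (0:ℝ) < η := hη
    have hx := Real.exp_pos (|lam| * t)
    have hev2 : ∀ᶠ e in 𝓝[>] (0:ℝ), e ∈ Ioo 0 (η / Real.exp (|lam| * t)) :=
      Ioo_mem_nhdsGT (by positivity)
    filter_upwards [hev, hev2] with e he he2
    have := (ode_bounds lam t l c ht E (U e) (fun r => R (U e r) / U e r ^ 2) hE hE0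
      (fun r hr => (hU e he r hr).1) (fun r hr => hd' e he r hr)
      (fun r hr => by
        have h3 := hbd e he r hr
        have h4 := (lt_div_iff₀ hx).mp he2.2
        have : U e r ∈ Ioo 0 η := ⟨(hU e he r hr).1, by linarith⟩
        exact le_of_lt (h2 this)) (fun r hr => hRc _ (hU e he r hr))).1
    rwa [hU0 e he] at this
  rw [tendsto_order]
  constructor
  · intro x hx
    have hEt := hEn t ht
    have hpos : 0 < E t + 1 := by linarith
    have := hlow (c - (c * E t - x) / (E t + 1)) (by
      have : 0 < (c * E t - x) / (E t + 1) := div_pos (by linarith) hpos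
      linarith)
    filter_upwards [this] with e he
    refine lt_of_lt_of_le ?_ he
    have : (c * E t - x) / (E t + 1) * E t < c * E t - x := by
      rw [div_mul_eq_mul_div, div_lt_iff₀ hpos]
      nlinarith
    linarith
  · intro x hx
    filter_upwards [hup] with e he
    linarith

lemma u_expand (A T0 : ℝ) (hA : 0 < A) (u : ℝ → ℝ) (hu : ∀ᶠ e in 𝓝[>] (0:ℝ), 0 < u e)
    (hT : Tendsto (fun e => A / u e - 1 / e) (𝓝[>] 0) (𝓝 T0)) :
    Tendsto (fun e => u e / e) (𝓝[>] 0) (𝓝 A) ∧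
    Tendsto (fun e => (u e - A * e) / e ^ 2) (𝓝[>] 0) (𝓝 (-(A * T0))) ∧
    Tendsto u (𝓝[>] 0) (𝓝 0) := by
  have he0 : Tendsto (fun e : ℝ => e) (𝓝[>] 0) (𝓝 0) := nhdsWithin_le_nhds
  have hden : Tendsto (fun e => 1 + e * (A / u e - 1 / e)) (𝓝[>] 0) (𝓝 1) := by
    have := (he0.mul hT).const_add 1
    simpa using this
  have hev : ∀ᶠ e in 𝓝[>] (0:ℝ), 0 < e := self_mem_nhdsWithin
  have h1 : Tendsto (fun e => u e / e) (𝓝[>] 0) (𝓝 A) := by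
    have := (tendsto_const_nhds (x := A)).div hden one_ne_zero
    rw [div_one] at this
    refine this.congr' ?_
    filter_upwards [hu, hev] with e h h'
    show A / (1 + e * (A / u e - 1 / e)) = u e / e
    have h5 : 1 + e * (A / u e - 1 / e) = e * A / u e := by
      field_simp
      ring
    rw [h5]
    field_simp
  refine ⟨h1, ?_, ?_⟩
  · have := (h1.mul hT).neg
    refine this.congr' ?_
    filter_upwards [hu, hev] with e h h'
    field_simp
    ring
  · have := h1.mul he0
    rw [mul_zero] at this
    refine this.congr' ?_
    filter_upwards [hev] with e h'
    field_simp

lemma pow_expand (A T0 q : ℝ) (hA : 0 < A) (u : ℝ → ℝ) (hu : ∀ᶠ e in 𝓝[>] (0:ℝ), 0 < u e)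
    (hT : Tendsto (fun e => A / u e - 1 / e) (𝓝[>] 0) (𝓝 T0)) (i : ℕ) :
    Tendsto (fun e => (q ^ i - (q - u e) ^ i) / e) (𝓝[>] 0) (𝓝 (i * q ^ (i-1) * A)) ∧
    Tendsto (fun e => ((q - u e) ^ i - q ^ i + e * (i * q ^ (i-1) * A)) / e ^ 2) (𝓝[>] 0)
      (𝓝 (i * q ^ (i-1) * (A * T0) + sPoly q i 0 * A ^ 2)) := by
  obtain ⟨h1, h2, h3⟩ := u_expand A T0 hA u hu hT
  have hev : ∀ᶠ e in 𝓝[>] (0:ℝ), 0 < e := self_mem_nhdsWithin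
  constructor
  · have h4 := (((dPoly_cont q i).tendsto 0).comp h3).mul h1
    rw [dPoly_zero] at h4
    refine h4.congr' ?_
    filter_upwards [hev] with e h'
    rw [dPoly_eq]
    simp only [Function.comp]
    field_simp
    ring
  · have h4 := (((sPoly_cont q i).tendsto 0).comp h3).mul (h1.pow 2)
    have h5 := (h2.const_mul (-(i * q ^ (i-1)))).add h4
    have e1 : -(i * q ^ (i-1)) * (-(A * T0)) + sPoly q i 0 * A ^ 2
      = i * q ^ (i-1) * (A * T0) + sPoly q i 0 * A ^ 2 := by ring
    rw [e1] at h5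
    refine h5.congr' ?_
    filter_upwards [hev] with e h'
    rw [sPoly_eq]
    simp only [Function.comp]
    field_simp
    ring

lemma core_mean
    (a : ℕ → ℝ) (f : ℝ → ℝ) (P : ℝ → ℕ → ℝ) (Φ : ℝ → ℝ → ℝ)
    (ha : ∀ k : ℕ, k ≠ 1 → 0 ≤ a k)
    (hf : ∀ x ∈ Icc (0:ℝ) 1, HasSum (fun k : ℕ => a k * x ^ k) (f x))
    (hPnn : ∀ t : ℝ, 0 ≤ t → ∀ j : ℕ, 0 ≤ P t j)
    (hPsum : ∀ t : ℝ, 0 ≤ t → HasSum (fun j : ℕ => P t j) 1)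
    (hΦ : ∀ t : ℝ, 0 ≤ t → ∀ x ∈ Icc (0:ℝ) 1, HasSum (fun j : ℕ => P t j * x ^ j) (Φ t x))
    (hΦ0 : ∀ x ∈ Icc (0:ℝ) 1, Φ 0 x = x)
    (hKol : ∀ x ∈ Icc (0:ℝ) 1, ∀ t : ℝ, 0 ≤ t → HasDerivAt (fun s => Φ s x) (f (Φ t x)) t)
    (hm : Summable (fun k : ℕ => (k : ℝ) * a k))
    (q fq : ℝ) (hq0 : 0 < q) (hq1 : q ≤ 1) (hfq0 : f q = 0)
    (hfq : HasSum (fun k : ℕ => (k : ℝ) * a k * q ^ (k - 1)) fq)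
    (b : ℝ)
    (hb : HasSum (fun k : ℕ => (k : ℝ) * ((k : ℝ) - 1) * a k * q ^ (k - 1)) b)
    (E : ℝ → ℝ) (hE : ∀ s, HasDerivAt E (Real.exp (fq * s)) s) (hE0 : E 0 = 0)
    (i : ℕ) (hi : 1 ≤ i) (t : ℝ) (ht : 0 ≤ t) (p : ℕ → ℝ)
    (hp : ∀ x ∈ Icc (0:ℝ) 1, HasSum (fun j : ℕ => p j * x ^ j) ((Φ t x) ^ i))
    (hpnn : ∀ j, 0 ≤ p j) :
    HasSum (fun j : ℕ => (j : ℝ) * ((j : ℝ) * q ^ ((j : ℤ) - (i : ℤ)) * p j /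
        ((i : ℝ) * Real.exp (fq * t))))
      (((i : ℝ) - 1) * Real.exp (fq * t) + b * E t + 1) := by
  have hqI : q ∈ Icc (0:ℝ) 1 := ⟨hq0.le, hq1⟩
  obtain ⟨K, hK0, hK⟩ := f_lip a f hf hm
  have hKq : ∀ x ∈ Icc (0:ℝ) 1, |f x| ≤ K * |x - q| := by
    intro x hx
    have := hK q hqI x hx
    rwa [hfq0, sub_zero] at this
  have hΦI : ∀ s, 0 ≤ s → ∀ x ∈ Icc (0:ℝ) 1, Φ s x ∈ Icc (0:ℝ) 1 := by
    intro s hs x hx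
    refine ⟨(hΦ s hs x hx).nonneg fun j => mul_nonneg (hPnn s hs j) (pow_nonneg hx.1 j), ?_⟩
    refine hasSum_le (fun j => ?_) (hΦ s hs x hx) (hPsum s hs)
    exact mul_le_of_le_one_right (hPnn s hs j) (pow_le_one₀ hx.1 hx.2)
  have hΦq : ∀ s, 0 ≤ s → Φ s q = q := by
    intro s hs
    exact Phi_q f K q s hKq hs (fun r => Φ r q) (hΦ0 q hqI) (fun r hr => hΦI r hr.1 q hqI)
      (fun r hr => hKol q hqI r hr.1)
  have hΦle : ∀ s, 0 ≤ s → ∀ x ∈ Icc (0:ℝ) q, Φ s x ≤ q := by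
    intro s hs x hx
    rw [← hΦq s hs]
    refine hasSum_le (fun j => ?_) (hΦ s hs x ⟨hx.1, hx.2.trans hq1⟩) (hΦ s hs q hqI)
    exact mul_le_mul_of_nonneg_left (pow_le_pow_left₀ hx.1 hx.2 j) (hPnn s hs j)
  set c : ℝ := b / (2 * q) with hc
  have hcs : HasSum (fun k => a k * sPoly q k 0) c := by
    refine hasSum_cast (hb.div_const (2 * q)) (fun k => ?_) rfl
    have := sPoly_zero q k
    rw [eq_div_iff (by positivity)]
    linear_combination a k * this
  let R : ℝ → ℝ := fun v => f (q - v) + fq * v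
  have hRs : ∀ v ∈ Ioc 0 q, HasSum (fun k => a k * sPoly q k v) (R v / v ^ 2) := by
    intro v hv
    have := (f_rem a f hf q (q - v) fq hqI ⟨by linarith [hv.2], by linarith [hv.1]⟩ hfq).div_const
      (v ^ 2)
    rw [hfq0, sub_sub_cancel, sub_zero] at this
    refine hasSum_cast this (fun k => ?_) rfl
    have := hv.1.ne'
    field_simp
  have hRn : ∀ v ∈ Ioc 0 q, ∀ k, 0 ≤ a k * sPoly q k v := fun v hv k =>
    sPoly_coef_nonneg a ha q v hq0.le (by linarith [hv.2]) k
  have hRl : ∀ v ∈ Ioc 0 q, ∀ k, a k * sPoly q k v ≤ a k * sPoly q k 0 := by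
    intro v hv k
    by_cases h : k = 1
    · subst h; simp [sPoly]
    · exact mul_le_mul_of_nonneg_left (sPoly_le q v hq0.le hv.1.le (by linarith [hv.2]) k) (ha k h)
  have hR0 : ∀ v ∈ Ioc 0 q, 0 ≤ R v / v ^ 2 := fun v hv => (hRs v hv).nonneg (hRn v hv)
  have hRc : ∀ v ∈ Ioc 0 q, R v / v ^ 2 ≤ c := fun v hv => hasSum_le (hRl v hv) (hRs v hv) hcs
  have hev : ∀ᶠ e in 𝓝[>] (0:ℝ), e ∈ Ioo 0 q := Ioo_mem_nhdsGT hq0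
  have hR : Tendsto (fun v => R v / v ^ 2) (𝓝[>] 0) (𝓝 c) := by
    have h5 : Tendsto (fun v => ∑' k, a k * sPoly q k v) (𝓝[>] 0)
        (𝓝 (∑' k, a k * sPoly q k 0)) := by
      refine tendsto_tsum_of_dominated_convergence (bound := fun k => a k * sPoly q k 0)
        hcs.summable (fun k => ?_) ?_
      · exact (((sPoly_cont q k).tendsto 0).mono_left nhdsWithin_le_nhds).const_mul _
      · filter_upwards [hev] with v hv k
        have hv' : v ∈ Ioc 0 q := ⟨hv.1, hv.2.le⟩
        rw [Real.norm_eq_abs, abs_of_nonneg (hRn v hv' k)]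
        exact hRl v hv' k
    rw [hcs.tsum_eq] at h5
    refine h5.congr' ?_
    filter_upwards [hev] with v hv
    exact (hRs v ⟨hv.1, hv.2.le⟩).tsum_eq
  let U : ℝ → ℝ → ℝ := fun e s => q - Φ s (q - e)
  have hxe : ∀ e ∈ Ioo 0 q, q - e ∈ Icc (0:ℝ) 1 := fun e he =>
    ⟨by linarith [he.2], by linarith [he.1]⟩
  have hU0 : ∀ e ∈ Ioo 0 q, U e 0 = e := by
    intro e he
    simp only [U]
    rw [hΦ0 _ (hxe e he)]; ring
  have hUd : ∀ e ∈ Ioo 0 q, ∀ s, 0 ≤ s → HasDerivAt (U e) (-f (Φ s (q - e))) s := by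
    intro e he s hs
    exact (hKol _ (hxe e he) s hs).const_sub q
  have hU : ∀ e ∈ Ioo 0 q, ∀ s ∈ Icc 0 t, 0 < U e s ∧ U e s ≤ q := by
    intro e he s hs
    constructor
    · refine u_pos (fun s => -f (Φ s (q - e))) K s hs.1 (U e) (by rw [hU0 e he]; exact he.1)
        (fun r hr => hUd e he r hr.1) (fun r hr => ?_)
      have h1 := hKq _ (hΦI r hr.1 _ (hxe e he))
      have h2 := hΦle r hr.1 (q - e) ⟨(hxe e he).1, by linarith [he.1]⟩
      rw [abs_of_nonpos (by linarith : Φ r (q - e) - q ≤ 0), neg_sub] at h1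
      simp only [U]
      linarith [le_abs_self (f (Φ r (q - e)))]
    · simp only [U]
      linarith [(hΦI s hs.1 _ (hxe e he)).1]
  have hT := core_T fq t c q hq0 ht E U R hE hE0 hU0 hU (fun e he s hs => by
    refine (hUd e he s hs.1).congr_deriv ?_
    simp only [U, R]
    rw [sub_sub_cancel]; ring) hR0 hRc hR
  set A := Real.exp (fq * t) with hAdef
  have hA : 0 < A := Real.exp_pos _
  obtain ⟨h1, h2⟩ := pow_expand A (c * E t) q hA (fun e => U e t)
    (by filter_upwards [hev] with e he using (hU e he t ⟨ht, le_rfl⟩).1) hT i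
  have hp0 := hp q hqI
  rw [hΦq t ht] at hp0
  obtain ⟨g1, g2⟩ := coeff_extract q _ _ hq0 p hpnn (fun e => (q - U e t) ^ i) (q ^ i) hp0
    (fun e he => by
      have := hp (q - e) ⟨by linarith [he.2], by linarith [he.1]⟩
      simp only [U, sub_sub_cancel]
      exact this) h1 h2
  have hi0 : (i:ℝ) ≠ 0 := by positivity
  have hcomb := (((g2.mul_left (2 * q ^ 2)).add (g1.mul_left q)).div_const (q ^ i * (i * A)))
  refine hasSum_cast hcomb (fun j => ?_) ?_
  · rw [zpow_sub₀ hq0.ne', zpow_natCast, zpow_natCast, dPoly_zero]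
    have e1 := sPoly_zero q j
    have e2 := qpow q j
    have hA' := hA.ne'
    field_simp
    linear_combination (j * p j) * e2 - (q * p j) * e1
  · have e1 := sPoly_zero q i
    have e2 := qpow q i
    have e3 : b = c * (2 * q) := by rw [hc]; field_simp
    have e4 : 2 * q ^ 2 * sPoly q i 0 = i * (i - 1) * q ^ i := by
      linear_combination q * e1 - ((i:ℝ) - 1) * e2
    have e5 : q * (i * q ^ (i-1)) = i * q ^ i := by linear_combination -e2
    rw [e3, eq_div_iff (by positivity)]
    linear_combination (-2 * A * q * c * E t - A) * e5 - A ^ 2 * e4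



theorem stmt_5
    (a : ℕ → ℝ) (f : ℝ → ℝ) (P : ℝ → ℕ → ℝ) (Φ : ℝ → ℝ → ℝ)
    (ha : ∀ k : ℕ, k ≠ 1 → 0 ≤ a k)
    (ha0 : 0 < a 0)
    (ha1 : HasSum (fun k : ℕ => if k = 1 then (0:ℝ) else a k) (-(a 1)))
    (ha01 : a 0 < -(a 1))
    (hf : ∀ x ∈ Set.Icc (0:ℝ) 1, HasSum (fun k : ℕ => a k * x ^ k) (f x))
    (hPnn : ∀ t : ℝ, 0 ≤ t → ∀ j : ℕ, 0 ≤ P t j)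
    (hPsum : ∀ t : ℝ, 0 ≤ t → HasSum (fun j : ℕ => P t j) 1)
    (hΦ : ∀ t : ℝ, 0 ≤ t → ∀ x ∈ Set.Icc (0:ℝ) 1, HasSum (fun j : ℕ => P t j * x ^ j) (Φ t x))
    (hΦ0 : ∀ x ∈ Set.Icc (0:ℝ) 1, Φ 0 x = x)
    (hKol : ∀ x ∈ Set.Icc (0:ℝ) 1, ∀ t : ℝ, 0 ≤ t → HasDerivAt (fun s => Φ s x) (f (Φ t x)) t)
    (m : ℝ)
    (hm : HasSum (fun k : ℕ => (k : ℝ) * a k) m)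
    (q fq β : ℝ)
    (hq : q = sInf {x : ℝ | x ∈ Set.Icc (0:ℝ) 1 ∧ f x = 0})
    (hfq : HasSum (fun k : ℕ => (k : ℝ) * a k * q ^ (k - 1)) fq)
    (hβ : β = Real.exp fq)
    (b : ℝ)
    (hb : HasSum (fun k : ℕ => (k : ℝ) * ((k : ℝ) - 1) * a k * q ^ (k - 1)) b)
    (Pi : ℕ → ℝ → ℕ → ℝ)
    (hPi : ∀ i : ℕ, 1 ≤ i → ∀ t : ℝ, 0 ≤ t → ∀ x ∈ Set.Icc (0:ℝ) 1,
      HasSum (fun j : ℕ => Pi i t j * x ^ j) ((Φ t x) ^ i))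
    (hPinn : ∀ i : ℕ, 1 ≤ i → ∀ t : ℝ, 0 ≤ t → ∀ j : ℕ, 0 ≤ Pi i t j)
    :
    (m = 0 → ∀ i : ℕ, 1 ≤ i → ∀ t : ℝ, 0 ≤ t →
        HasSum (fun j : ℕ => (j : ℝ) * ((j : ℝ) * q ^ ((j : ℤ) - (i : ℤ)) * Pi i t j / ((i : ℝ) * β ^ t)))
          (((i : ℝ) - 1) * β ^ t + b * t + 1)) ∧
    (m ≠ 0 → ∀ i : ℕ, 1 ≤ i → ∀ t : ℝ, 0 ≤ t →
        HasSum (fun j : ℕ => (j : ℝ) * ((j : ℝ) * q ^ ((j : ℤ) - (i : ℤ)) * Pi i t j / ((i : ℝ) * β ^ t)))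
          (((i : ℝ) - 1) * β ^ t + 1 + b / |Real.log β| * (1 - β ^ t))) := by
  have hf1 : f 1 = 0 := by
    have h1 := hf 1 ⟨zero_le_one, le_rfl⟩
    have h2 : HasSum (fun k : ℕ => if k = 1 then a 1 else 0) (a 1) := hasSum_ite_eq 1 (a 1)
    have h3 := ha1.add h2
    rw [neg_add_cancel] at h3
    refine h1.unique (hasSum_cast h3 (fun k => ?_) rfl)
    by_cases h : k = 1
    · simp [h]
    · simp [h]
  have hf0 : f 0 = a 0 := by
    have h1 := hf 0 ⟨le_rfl, zero_le_one⟩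
    have h2 := hasSum_single (f := fun k : ℕ => a k * (0:ℝ) ^ k) 0 (by
      intro k hk; simp [hk])
    simpa using h1.unique h2
  obtain ⟨K, hK0, hK⟩ := f_lip a f hf hm.summable
  have hcont : ContinuousOn f (Icc 0 1) := by
    have : LipschitzOnWith (Real.toNNReal K) f (Icc 0 1) := by
      refine LipschitzOnWith.of_dist_le_mul fun x hx y hy => ?_
      rw [Real.dist_eq, Real.dist_eq, Real.coe_toNNReal K hK0]
      exact hK y hy x hx
    exact this.continuousOn
  have hZ : IsClosed {x : ℝ | x ∈ Set.Icc (0:ℝ) 1 ∧ f x = 0} :=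
    hcont.preimage_isClosed_of_isClosed isClosed_Icc isClosed_singleton
  have hbdd : BddBelow {x : ℝ | x ∈ Set.Icc (0:ℝ) 1 ∧ f x = 0} := ⟨0, fun x hx => hx.1.1⟩
  have hqmem : q ∈ {x : ℝ | x ∈ Set.Icc (0:ℝ) 1 ∧ f x = 0} := by
    rw [hq]
    exact hZ.csInf_mem ⟨1, ⟨zero_le_one, le_rfl⟩, hf1⟩ hbdd
  have hqle : ∀ x ∈ Icc (0:ℝ) 1, f x = 0 → q ≤ x := by
    intro x hx h
    rw [hq]; exact csInf_le hbdd ⟨hx, h⟩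
  obtain ⟨hqI, hfq0⟩ := hqmem
  have hq0 : 0 < q := by
    refine lt_of_le_of_ne hqI.1 fun h => ?_
    rw [← h, hf0] at hfq0
    linarith
  have hβt : ∀ t : ℝ, β ^ t = Real.exp (fq * t) := by
    intro t; rw [hβ, ← Real.exp_mul]
  have hm1 : HasSum (fun k : ℕ => (k : ℝ) * a k * (1:ℝ) ^ (k - 1)) m := by simpa using hm
  constructor
  · intro hm0 i hi t ht
    have hq1 : q = 1 := by
      by_contra hne
      have := tangent_lt a f ha ha1 ha01 hf 1 q m ⟨zero_le_one, le_rfl⟩ one_pos hqI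
        (fun h => hne h.symm) hm1
      rw [hf1, hfq0, hm0] at this
      simp at this
    have hfqm : fq = 0 := by
      rw [← hm0]; rw [hq1] at hfq; exact hfq.unique hm1
    rw [hβt]
    exact core_mean a f P Φ ha hf hPnn hPsum hΦ hΦ0 hKol hm.summable q fq hq0 hqI.2 hfq0 hfq b hb
      (fun s => s) (fun s => (hasDerivAt_id s).congr_deriv (by simp [hfqm])) rfl i hi t ht (Pi i t)
      (hPi i hi t ht) (hPinn i hi t ht)
  · intro hm0 i hi t ht
    have hneg : fq < 0 := by
      by_cases hq1 : q = 1
      · have hfqm : fq = m := by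
          rw [hq1] at hfq; exact hfq.unique hm1
        by_contra hc
        have hpos : 0 < fq := lt_of_le_of_ne (not_lt.mp hc) (by rw [hfqm]; exact hm0.symm)
        -- f is negative just left of 1
        have hcs : HasSum (fun k => a k * sPoly q k 0) (b / (2 * q)) := by
          refine hasSum_cast (hb.div_const (2 * q)) (fun k => ?_) rfl
          have := sPoly_zero q k
          rw [eq_div_iff (by positivity)]
          linear_combination a k * this
        have hc0 : 0 ≤ b / (2 * q) := hcs.nonneg fun k =>
          sPoly_coef_nonneg a ha q 0 hq0.le (by linarith) k
        set c := b / (2 * q)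
        have hle : ∀ v ∈ Ioc 0 q, f (q - v) + fq * v ≤ c * v ^ 2 := by
          intro v hv
          have h1 := f_rem a f hf q (q - v) fq hqI ⟨by linarith [hv.2], by linarith [hv.1, hqI.2]⟩ hfq
          rw [hfq0, sub_sub_cancel, sub_zero] at h1
          refine hasSum_le (fun k => ?_) h1 (hcs.mul_right (v ^ 2))
          refine mul_le_mul_of_nonneg_right ?_ (sq_nonneg v)
          by_cases h : k = 1
          · subst h; simp [sPoly]
          · exact mul_le_mul_of_nonneg_left
              (sPoly_le q v hq0.le hv.1.le (by linarith [hv.2]) k) (ha k h)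
        obtain ⟨v, hv0, hv1, hv2⟩ : ∃ v : ℝ, 0 < v ∧ v ≤ q ∧ c * v < fq := by
          refine ⟨min q (fq / (c + 1) / 2), ?_, min_le_left _ _, ?_⟩
          · exact lt_min hq0 (by positivity)
          · have h1 : c * min q (fq / (c + 1) / 2) ≤ c * (fq / (c + 1) / 2) :=
              mul_le_mul_of_nonneg_left (min_le_right _ _) hc0
            refine lt_of_le_of_lt h1 ?_
            rw [div_div, ← mul_div_assoc, div_lt_iff₀ (by positivity)]
            nlinarith [mul_nonneg hc0 hpos.le]
        have hfneg : f (q - v) < 0 := by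
          have := hle v ⟨hv0, hv1⟩
          nlinarith
        have hivt := intermediate_value_Icc' (by linarith : (0:ℝ) ≤ q - v)
          (hcont.mono (Icc_subset_Icc le_rfl (by linarith [hqI.2])))
        obtain ⟨z, hz, hz0⟩ := hivt ⟨hfneg.le, by rw [hf0]; exact ha0.le⟩
        have := hqle z ⟨hz.1, by linarith [hz.2, hqI.2]⟩ hz0
        linarith [hz.2]
      · have hlt : q < 1 := lt_of_le_of_ne hqI.2 hq1
        have := tangent_lt a f ha ha1 ha01 hf q 1 fq hqI hq0 ⟨zero_le_one, le_rfl⟩ hq1 hfq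
        rw [hf1, hfq0] at this
        nlinarith
    have hlog : |Real.log β| = -fq := by rw [hβ, Real.log_exp, abs_of_neg hneg]
    have key := core_mean a f P Φ ha hf hPnn hPsum hΦ hΦ0 hKol hm.summable q fq hq0 hqI.2 hfq0 hfq
      b hb (fun s => (Real.exp (fq * s) - 1) / fq) (fun s => by
        have h1 : HasDerivAt (fun s => Real.exp (fq * s)) (Real.exp (fq * s) * fq) s := by
          have := ((hasDerivAt_id s).const_mul fq).exp
          simpa using this
        refine ((h1.sub_const 1).div_const fq).congr_deriv ?_
        exact mul_div_cancel_right₀ _ hneg.ne) (by simp) i hi t ht (Pi i t)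
      (hPi i hi t ht) (hPinn i hi t ht)
    rw [hβt, hlog]
    refine hasSum_cast key (fun j => rfl) ?_
    have := hneg.ne
    field_simp
    ring
end

section
/- Assume f'(q) is finite (automatic when q < 1; when q = 1 assume f'(1⁻) < ∞). Then for every t ≥ 0 the derivative of Φ(t;·) at the extinction probability equals ∂Φ/∂x(t;q) = exp(t·f'(q)) = β^t; consequently Σ_{j≥1} Q_{ij}(t) = 1 for every i ≥ 1, i.e. Σ_{j≥1} j·q^j·P_{ij}(t) = i·q^i·β^t. -/
open scoped Topology

open Set Filter

noncomputable def gk (q : ℝ) (k : ℕ) (x : ℝ) : ℝ :=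
  ∑ i ∈ Finset.range k, x ^ i * q ^ (k - 1 - i)

lemma gk_mul (q : ℝ) (k : ℕ) (x : ℝ) : gk q k x * (x - q) = x ^ k - q ^ k :=
  geom_sum₂_mul x q k

lemma gk_self (q : ℝ) (k : ℕ) : gk q k q = k * q ^ (k - 1) := geom_sum₂_self q k

lemma gk_mono {q x y : ℝ} (hq : 0 ≤ q) (hx : 0 ≤ x) (hxy : x ≤ y) (k : ℕ) :
    gk q k x ≤ gk q k y := by
  unfold gk
  gcongr

lemma gk_nonneg {q x : ℝ} (hq : 0 ≤ q) (hx : 0 ≤ x) (k : ℕ) : 0 ≤ gk q k x := by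
  unfold gk
  positivity

lemma gk_cont (q : ℝ) (k : ℕ) : Continuous (gk q k) := by
  unfold gk
  fun_prop

lemma gk_one (q x : ℝ) : gk q 1 x = 1 := by simp [gk]

/-- Difference quotients of a nonnegative power series determine the series of derivatives. -/
lemma hasSum_of_deriv (c : ℕ → ℝ) (hc : ∀ k, 0 ≤ c k) (G : ℝ → ℝ) (q L : ℝ) (hq : 0 < q)
    (hG : ∀ x ∈ Icc 0 q, HasSum (fun k => c k * x ^ k) (G x))
    (hL : HasDerivWithinAt G L (Iio q) q) :
    HasSum (fun k : ℕ => (k : ℝ) * c k * q ^ (k - 1)) L := by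
  have hslope : ∀ x ∈ Ico 0 q, HasSum (fun k => c k * gk q k x) (slope G q x) := by
    intro x hx
    have h1 := ((hG x ⟨hx.1, hx.2.le⟩).sub (hG q ⟨hq.le, le_rfl⟩)).div_const (x - q)
    have hne : x - q ≠ 0 := by linarith [hx.2]
    rw [slope_def_field]
    refine h1.congr_fun ?_ |> fun h => h
    intro k
    have := gk_mul q k x
    field_simp
    linear_combination c k * this
  have hT : Tendsto (slope G q) (𝓝[<] q) (𝓝 L) := by
    have := hasDerivWithinAt_iff_tendsto_slope.1 hL
    simpa using this
  have hev : ∀ᶠ x in 𝓝[<] q, x ∈ Ico 0 q := Ico_mem_nhdsLT hq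
  have hfin : ∀ s : Finset ℕ, ∑ k ∈ s, c k * gk q k q ≤ L := by
    intro s
    have hcont : Continuous (fun x => ∑ k ∈ s, c k * gk q k x) :=
      continuous_finsetSum _ fun k _ => continuous_const.mul (gk_cont q k)
    have h1 : Tendsto (fun x => ∑ k ∈ s, c k * gk q k x) (𝓝[<] q)
        (𝓝 (∑ k ∈ s, c k * gk q k q)) := (hcont.tendsto q).mono_left nhdsWithin_le_nhds
    refine le_of_tendsto_of_tendsto h1 hT ?_
    filter_upwards [hev] with x hx
    exact sum_le_hasSum s (fun k _ => mul_nonneg (hc k) (gk_nonneg hq.le hx.1 k)) (hslope x hx)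
  have hnn : ∀ k, 0 ≤ c k * gk q k q := fun k => mul_nonneg (hc k) (gk_nonneg hq.le hq.le k)
  have hsum : Summable (fun k => c k * gk q k q) := summable_of_sum_le hnn hfin
  have hle : ∑' k, c k * gk q k q ≤ L := hsum.tsum_le_of_sum_le hfin
  have hge : L ≤ ∑' k, c k * gk q k q := by
    refine le_of_tendsto hT ?_
    filter_upwards [hev] with x hx
    exact hasSum_le (fun k => mul_le_mul_of_nonneg_left (gk_mono hq.le hx.1 hx.2.le k) (hc k))
      (hslope x hx) hsum.hasSum
  have := hsum.hasSum
  rw [le_antisymm hle hge] at this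
  convert this using 2 with k
  rw [gk_self]; ring

theorem stmt_7
    (a : ℕ → ℝ) (f : ℝ → ℝ) (P : ℝ → ℕ → ℝ) (Φ : ℝ → ℝ → ℝ)
    (ha : ∀ k : ℕ, k ≠ 1 → 0 ≤ a k)
    (ha0 : 0 < a 0)
    (ha1 : HasSum (fun k : ℕ => if k = 1 then (0:ℝ) else a k) (-(a 1)))
    (ha01 : a 0 < -(a 1))
    (hf : ∀ x ∈ Set.Icc (0:ℝ) 1, HasSum (fun k : ℕ => a k * x ^ k) (f x))
    (hPnn : ∀ t : ℝ, 0 ≤ t → ∀ j : ℕ, 0 ≤ P t j)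
    (hPsum : ∀ t : ℝ, 0 ≤ t → HasSum (fun j : ℕ => P t j) 1)
    (hΦ : ∀ t : ℝ, 0 ≤ t → ∀ x ∈ Set.Icc (0:ℝ) 1, HasSum (fun j : ℕ => P t j * x ^ j) (Φ t x))
    (hΦ0 : ∀ x ∈ Set.Icc (0:ℝ) 1, Φ 0 x = x)
    (hKol : ∀ x ∈ Set.Icc (0:ℝ) 1, ∀ t : ℝ, 0 ≤ t → HasDerivAt (fun s => Φ s x) (f (Φ t x)) t)
    (q fq β : ℝ)
    (hq : q = sInf {x : ℝ | x ∈ Set.Icc (0:ℝ) 1 ∧ f x = 0})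
    (hfq : HasSum (fun k : ℕ => (k : ℝ) * a k * q ^ (k - 1)) fq)
    (hβ : β = Real.exp fq)
    (Pi : ℕ → ℝ → ℕ → ℝ)
    (hPi : ∀ i : ℕ, 1 ≤ i → ∀ t : ℝ, 0 ≤ t → ∀ x ∈ Set.Icc (0:ℝ) 1,
      HasSum (fun j : ℕ => Pi i t j * x ^ j) ((Φ t x) ^ i))
    (hPinn : ∀ i : ℕ, 1 ≤ i → ∀ t : ℝ, 0 ≤ t → ∀ j : ℕ, 0 ≤ Pi i t j)
    :
    ∀ t : ℝ, 0 ≤ t →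
      HasSum (fun j : ℕ => (j : ℝ) * P t j * q ^ (j - 1)) (β ^ t) ∧
      β ^ t = Real.exp (t * fq) ∧
      ∀ i : ℕ, 1 ≤ i →
        HasSum (fun j : ℕ => (j : ℝ) * q ^ j * Pi i t j) ((i : ℝ) * q ^ i * β ^ t) := by
  have hset1 : f 1 = 0 := by
    have h1 := hf 1 (by simp)
    have h2 : HasSum (fun k : ℕ => if k = 1 then a 1 else 0) (a 1) := hasSum_ite_eq 1 (a 1)
    have h3 := ha1.add h2
    rw [neg_add_cancel] at h3
    refine h1.unique ?_
    convert h3 using 2 with k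
    by_cases hk : k = 1 <;> simp [hk]
  have hf0 : f 0 = a 0 := by
    refine (hf 0 (by simp)).unique ?_
    convert hasSum_ite_eq 0 (a 0) using 2 with k
    by_cases hk : k = 0 <;> simp [hk]
  have habs : Summable (fun k => |a k|) := by
    have := (hf 1 (by simp)).summable.abs
    simpa using this
  have hfc : ContinuousOn f (Icc 0 1) := by
    have h1 : ContinuousOn (fun x => ∑' k, a k * x ^ k) (Icc (0:ℝ) 1) := by
      refine continuousOn_tsum (fun k => by fun_prop) habs ?_
      intro k x hx
      rw [Real.norm_eq_abs, abs_mul]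
      refine mul_le_of_le_one_right (abs_nonneg _) ?_
      rw [abs_of_nonneg (pow_nonneg hx.1 k)]
      exact pow_le_one₀ hx.1 hx.2
    exact h1.congr fun x hx => (hf x hx).tsum_eq.symm
  set S := {x : ℝ | x ∈ Set.Icc (0:ℝ) 1 ∧ f x = 0} with hS
  have hSb : BddBelow S := ⟨0, fun x hx => hx.1.1⟩
  have hScl : IsClosed S := by
    have : S = Icc 0 1 ∩ f ⁻¹' {0} := by ext; simp [hS]
    rw [this]
    exact hfc.preimage_isClosed_of_isClosed isClosed_Icc isClosed_singleton
  have hqS : q ∈ S := hq ▸ hScl.csInf_mem ⟨1, by simp, hset1⟩ hSb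
  obtain ⟨hq01, hfq0⟩ := hqS
  have hqpos : 0 < q := by
    rcases hq01.1.lt_or_eq with h | h
    · exact h
    · rw [← h, hf0] at hfq0; linarith
  have hfpos : ∀ x ∈ Icc 0 q, 0 ≤ f x := by
    intro x hx
    by_contra! hneg
    have hx1 : x ≤ 1 := hx.2.trans hq01.2
    obtain ⟨y, hy, hfy⟩ := intermediate_value_Icc' hx.1
      (hfc.mono (Icc_subset_Icc le_rfl hx1)) (show (0:ℝ) ∈ Icc (f x) (f 0) from ⟨hneg.le, by rw [hf0]; exact ha0.le⟩)
    have : q ≤ y := hq ▸ csInf_le hSb ⟨⟨hy.1, hy.2.trans hx1⟩, hfy⟩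
    have : x = q := le_antisymm hx.2 (this.trans hy.2)
    rw [this, hfq0] at hneg
    exact lt_irrefl _ hneg
  have hfneg : ∀ y ∈ Icc q 1, f y ≤ 0 := by
    intro y hy
    rcases hq01.2.lt_or_eq with h | h
    swap
    · have : y = 1 := le_antisymm hy.2 (h ▸ hy.1)
      rw [this, hset1]
    have h1q : 0 < 1 - q := by linarith
    set α := (1 - y) / (1 - q) with hα
    have hα0 : 0 ≤ α := div_nonneg (by linarith [hy.2]) h1q.le
    have hα1 : 0 ≤ 1 - α := by
      rw [sub_nonneg, hα, div_le_one h1q]; linarith [hy.1]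
    have hyα : α * q + (1 - α) * 1 = y := by
      rw [hα]; field_simp; ring
    have hs := ((hf q hq01).mul_left α).add ((hf 1 (by simp)).mul_left (1 - α))
    rw [hfq0, hset1, mul_zero, mul_zero, add_zero] at hs
    refine hasSum_le (fun k => ?_) (hf y ⟨hq01.1.trans hy.1, hy.2⟩) hs
    by_cases hk : k = 1
    · subst hk
      rw [← hyα]; apply le_of_eq; ring
    · have hcv := (convexOn_pow k : ConvexOn ℝ (Ici 0) fun x : ℝ => x ^ k).2
        (show q ∈ Ici (0:ℝ) from hq01.1) (show (1:ℝ) ∈ Ici (0:ℝ) from mem_Ici.2 zero_le_one) hα0 hα1 (by ring)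
      simp only [smul_eq_mul] at hcv
      rw [hyα] at hcv
      have := mul_le_mul_of_nonneg_left hcv (ha k hk)
      linarith
  have hsub : ∀ x ∈ Icc 0 q, x ∈ Icc (0:ℝ) 1 := fun x hx => ⟨hx.1, hx.2.trans hq01.2⟩
  have hΦ01 : ∀ t, 0 ≤ t → ∀ x ∈ Icc (0:ℝ) 1, Φ t x ∈ Icc (0:ℝ) 1 := by
    intro t ht x hx
    refine ⟨(hΦ t ht x hx).nonneg fun j => mul_nonneg (hPnn t ht j) (pow_nonneg hx.1 j), ?_⟩
    exact hasSum_le (fun j => mul_le_of_le_one_right (hPnn t ht j) (pow_le_one₀ hx.1 hx.2))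
      (hΦ t ht x hx) (hPsum t ht)
  have hΦq : ∀ t, 0 ≤ t → Φ t q = q := by
    have hanti : AntitoneOn (fun s => (Φ s q - q) ^ 2) (Ici 0) := by
      have hd : ∀ s, 0 ≤ s → HasDerivAt (fun s => (Φ s q - q) ^ 2)
          (2 * (Φ s q - q) * f (Φ s q)) s := by
        intro s hs
        have := ((hKol q hq01 s hs).sub_const q).pow 2
        refine this.congr_deriv ?_
        norm_num
      refine antitoneOn_of_hasDerivWithinAt_nonpos (convex_Ici 0)
        (fun s hs => (hd s hs).continuousAt.continuousWithinAt)
        (fun s hs => (hd s (interior_subset hs)).hasDerivWithinAt) ?_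
      intro s hs
      have h01 := hΦ01 s (interior_subset hs) q hq01
      rcases le_total (Φ s q) q with h | h
      · have := hfpos _ ⟨h01.1, h⟩
        nlinarith
      · have := hfneg _ ⟨h, h01.2⟩
        nlinarith
    intro t ht
    have := hanti (self_mem_Ici) (show t ∈ Ici (0:ℝ) from ht) ht
    simp only [hΦ0 q hq01, sub_self] at this
    have h0 : (Φ t q - q) ^ 2 = 0 := le_antisymm (by simpa using this) (sq_nonneg _)
    have := pow_eq_zero_iff (two_ne_zero) |>.1 h0
    linarith
  -- the slope function
  have hgs : Summable (fun k => |a k| * gk q k q) := by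
    have := hfq.summable.abs
    refine this.congr fun k => ?_
    rw [gk_self, abs_mul, abs_mul, abs_of_nonneg (pow_nonneg hq01.1 _), Nat.abs_cast]
    ring
  have hgb : ∀ k, ∀ x ∈ Icc 0 q, ‖a k * gk q k x‖ ≤ |a k| * gk q k q := by
    intro k x hx
    rw [Real.norm_eq_abs, abs_mul, abs_of_nonneg (gk_nonneg hq01.1 hx.1 k)]
    exact mul_le_mul_of_nonneg_left (gk_mono hq01.1 hx.1 hx.2 k) (abs_nonneg _)
  obtain ⟨h, hh⟩ : ∃ h : ℝ → ℝ, h = fun x => ∑' k, a k * gk q k x := ⟨_, rfl⟩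
  have hhs : ∀ x ∈ Icc 0 q, HasSum (fun k => a k * gk q k x) (h x) := by
    intro x hx
    rw [hh]
    exact (Summable.of_norm_bounded hgs fun k => hgb k x hx).hasSum
  have hqq : q ∈ Icc 0 q := ⟨hq01.1, le_rfl⟩
  have hhq : h q = fq := by
    refine (hhs q hqq).unique ?_
    convert hfq using 2 with k
    rw [gk_self]; ring
  have hhc : ContinuousOn h (Icc 0 q) := by
    rw [hh]
    exact continuousOn_tsum (fun k => (continuous_const.mul (gk_cont q k)).continuousOn) hgs hgb
  have hfh : ∀ x ∈ Icc 0 q, f x = -(h x * (q - x)) := by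
    intro x hx
    have h1 := (hf x (hsub x hx)).sub (hf q hq01)
    have h2 := (hhs x hx).mul_right (x - q)
    have h3 : f x - f q = h x * (x - q) := by
      refine h1.unique ?_
      refine h2.congr_fun fun k => ?_
      rw [mul_assoc, gk_mul]; ring
    rw [hfq0] at h3
    linarith
  have hhm : ∀ x ∈ Icc 0 q, ∀ y ∈ Icc 0 q, x ≤ y → h x ≤ h y := by
    intro x hx y hy hxy
    refine hasSum_le (fun k => ?_) (hhs x hx) (hhs y hy)
    by_cases hk : k = 1
    · subst hk; simp [gk_one]
    · exact mul_le_mul_of_nonneg_left (gk_mono hq01.1 hx.1 hxy k) (ha k hk)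
  have hΦq' : ∀ t, 0 ≤ t → ∀ x ∈ Icc 0 q, Φ t x ∈ Icc 0 q := by
    intro t ht x hx
    refine ⟨(hΦ01 t ht x (hsub x hx)).1, ?_⟩
    rw [← hΦq t ht]
    exact hasSum_le (fun j => mul_le_mul_of_nonneg_left (pow_le_pow_left₀ hx.1 hx.2 j)
      (hPnn t ht j)) (hΦ t ht x (hsub x hx)) (hΦ t ht q hq01)
  have hΦx : ∀ t, 0 ≤ t → ∀ x ∈ Icc 0 q, x ≤ Φ t x := by
    intro t ht x hx
    have hm : MonotoneOn (fun s => Φ s x) (Ici 0) := by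
      refine monotoneOn_of_hasDerivWithinAt_nonneg (convex_Ici 0)
        (fun s hs => (hKol x (hsub x hx) s hs).continuousAt.continuousWithinAt)
        (fun s hs => (hKol x (hsub x hx) s (interior_subset hs)).hasDerivWithinAt) ?_
      intro s hs
      exact hfpos _ (hΦq' s (interior_subset hs) x hx)
    have := hm (self_mem_Ici) (show t ∈ Ici (0:ℝ) from ht) ht
    simpa [hΦ0 x (hsub x hx)] using this
  have hdw : ∀ (r : ℝ), ∀ x ∈ Icc 0 q, ∀ s, 0 ≤ s →
      HasDerivAt (fun s => (q - Φ s x) * Real.exp (-(r * s)))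
        ((h (Φ s x) - r) * (q - Φ s x) * Real.exp (-(r * s))) s := by
    intro r x hx s hs
    have h1 := (hKol x (hsub x hx) s hs).const_sub q
    have h2 : HasDerivAt (fun s : ℝ => Real.exp (-(r * s))) (Real.exp (-(r * s)) * (-(r * 1))) s :=
      (((hasDerivAt_id s).const_mul r).neg).exp
    have h3 := h1.mul h2
    refine h3.congr_deriv ?_
    rw [hfh _ (hΦq' s hs x hx)]; ring
  have hup : ∀ t, 0 ≤ t → ∀ x ∈ Icc 0 q, q - Φ t x ≤ (q - x) * Real.exp (fq * t) := by
    intro t ht x hx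
    have hm : AntitoneOn (fun s => (q - Φ s x) * Real.exp (-(fq * s))) (Ici 0) := by
      refine antitoneOn_of_hasDerivWithinAt_nonpos (convex_Ici 0)
        (fun s hs => (hdw fq x hx s hs).continuousAt.continuousWithinAt)
        (fun s hs => (hdw fq x hx s (interior_subset hs)).hasDerivWithinAt) ?_
      intro s hs
      have hu := hΦq' s (interior_subset hs) x hx
      have h1 : h (Φ s x) ≤ fq := hhq ▸ hhm _ hu q hqq hu.2
      exact mul_nonpos_of_nonpos_of_nonneg
        (mul_nonpos_of_nonpos_of_nonneg (by linarith) (by linarith [hu.2])) (Real.exp_pos _).le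
    have := hm (self_mem_Ici) (show t ∈ Ici (0:ℝ) from ht) ht
    simp only [hΦ0 x (hsub x hx), mul_zero, neg_zero, Real.exp_zero, mul_one] at this
    rw [Real.exp_neg, ← div_eq_mul_inv, div_le_iff₀ (Real.exp_pos _)] at this
    exact this
  have hlo : ∀ t, 0 ≤ t → ∀ x ∈ Icc 0 q, (q - x) * Real.exp (h x * t) ≤ q - Φ t x := by
    intro t ht x hx
    have hm : MonotoneOn (fun s => (q - Φ s x) * Real.exp (-(h x * s))) (Ici 0) := by
      refine monotoneOn_of_hasDerivWithinAt_nonneg (convex_Ici 0)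
        (fun s hs => (hdw (h x) x hx s hs).continuousAt.continuousWithinAt)
        (fun s hs => (hdw (h x) x hx s (interior_subset hs)).hasDerivWithinAt) ?_
      intro s hs
      have hu := hΦq' s (interior_subset hs) x hx
      have h1 : h x ≤ h (Φ s x) := hhm x hx _ hu (hΦx s (interior_subset hs) x hx)
      exact mul_nonneg (mul_nonneg (by linarith) (by linarith [hu.2])) (Real.exp_pos _).le
    have := hm (self_mem_Ici) (show t ∈ Ici (0:ℝ) from ht) ht
    simp only [hΦ0 x (hsub x hx), mul_zero, neg_zero, Real.exp_zero, mul_one] at this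
    rw [Real.exp_neg, ← div_eq_mul_inv, le_div_iff₀ (Real.exp_pos _)] at this
    exact this
  intro t ht
  have hβt : β ^ t = Real.exp (t * fq) := by
    rw [hβ, ← Real.exp_mul, mul_comm]
  have hD : HasDerivWithinAt (Φ t) (β ^ t) (Iio q) q := by
    rw [hasDerivWithinAt_iff_tendsto_slope]
    have hev : ∀ᶠ x in 𝓝[<] q, x ∈ Ico 0 q := Ico_mem_nhdsLT hqpos
    have hdiff : Iio q \ {q} = Iio q := by simp
    rw [hdiff, hβt]
    have hh1 : Tendsto h (𝓝[<] q) (𝓝 fq) := by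
      have h1 := (hhc q hqq).tendsto
      rw [hhq] at h1
      refine h1.mono_left ?_
      rw [← nhdsWithin_Ico_eq_nhdsLT hqpos]
      exact nhdsWithin_mono _ Ico_subset_Icc_self
    have hh2 : Tendsto (fun x => Real.exp (h x * t)) (𝓝[<] q) (𝓝 (Real.exp (t * fq))) := by
      rw [mul_comm t fq]
      exact (Real.continuous_exp.tendsto _).comp (hh1.mul_const t)
    refine tendsto_of_tendsto_of_tendsto_of_le_of_le' hh2 tendsto_const_nhds ?_ ?_
    · filter_upwards [hev] with x hx
      have := hlo t ht x ⟨hx.1, hx.2.le⟩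
      rw [slope_comm, slope_def_field, hΦq t ht, le_div_iff₀ (by linarith [hx.2])]
      linarith
    · filter_upwards [hev] with x hx
      have := hup t ht x ⟨hx.1, hx.2.le⟩
      rw [slope_comm, slope_def_field, hΦq t ht, div_le_iff₀ (by linarith [hx.2]), mul_comm t fq]
      linarith
  refine ⟨?_, hβt, ?_⟩
  · exact hasSum_of_deriv (P t) (hPnn t ht) (Φ t) q _ hqpos
      (fun x hx => hΦ t ht x (hsub x hx)) hD
  · intro i hi
    have hDi := hD.pow i
    rw [hΦq t ht] at hDi
    have := (hasSum_of_deriv (Pi i t) (hPinn i hi t ht) (fun x => (Φ t x) ^ i) q _ hqpos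
      (fun x hx => hPi i hi t ht x (hsub x hx)) hDi).mul_left q
    have e1 : (i : ℝ) * q ^ i * β ^ t = q * ((i : ℝ) * q ^ (i - 1) * β ^ t) := by
      obtain ⟨m, rfl⟩ : ∃ m, i = m + 1 := ⟨i - 1, by omega⟩
      simp only [Nat.add_sub_cancel, pow_succ]; ring
    rw [e1]
    refine this.congr_fun fun j => ?_
    rcases j with _ | j
    · simp
    · simp only [Nat.add_sub_cancel, pow_succ]; ring
end

section
/- In the critical case, for every 0 ≤ r < 1 one has, uniformly in x ∈ [0,r], 1 − (1 − Φ(t;x))/(1 − Φ(t;0)) = O(ln t / t) as t → ∞; that is, sup_{x∈[0,r]} |1 − (1 − Φ(t;x))/(1 − Φ(t;0))| = O(ln t / t). -/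
open scoped Topology

lemma aux_D (x : ℝ) (h0 : 0 ≤ x) (h1 : x ≤ 1) (k : ℕ) :
    0 ≤ x ^ k - 1 - k * (x - 1) ∧ ((k:ℝ) - 1) * (1 - x) ^ 2 ≤ x ^ k - 1 - k * (x - 1) ∧
      x ^ k - 1 - k * (x - 1) ≤ (k:ℝ) * (k - 1) * (1 - x) ^ 2 := by
  induction k with
  | zero => simp; positivity
  | succ k ih =>
    obtain ⟨i0, i1, i2⟩ := ih
    have e : x ^ (k+1) - 1 - ((k+1:ℕ):ℝ) * (x - 1)
        = x * (x ^ k - 1 - k * (x - 1)) + k * (1 - x) ^ 2 := by push_cast; ring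
    rw [e]
    set D := x ^ k - 1 - k * (x - 1)
    have hk : (0:ℝ) ≤ k := Nat.cast_nonneg k
    have hq : 0 ≤ (k:ℝ) * (1 - x) ^ 2 := by positivity
    have hx : 0 ≤ x * D := mul_nonneg h0 i0
    have hx2 : x * D ≤ D := mul_le_of_le_one_left i0 h1
    push_cast
    refine ⟨by linarith, by linarith, by nlinarith⟩

theorem stmt_9
    (a : ℕ → ℝ) (f : ℝ → ℝ) (P : ℝ → ℕ → ℝ) (Φ : ℝ → ℝ → ℝ)
    (ha : ∀ k : ℕ, k ≠ 1 → 0 ≤ a k)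
    (ha0 : 0 < a 0)
    (ha1 : HasSum (fun k : ℕ => if k = 1 then (0:ℝ) else a k) (-(a 1)))
    (ha01 : a 0 < -(a 1))
    (hf : ∀ x ∈ Set.Icc (0:ℝ) 1, HasSum (fun k : ℕ => a k * x ^ k) (f x))
    (hPnn : ∀ t : ℝ, 0 ≤ t → ∀ j : ℕ, 0 ≤ P t j)
    (hPsum : ∀ t : ℝ, 0 ≤ t → HasSum (fun j : ℕ => P t j) 1)
    (hΦ : ∀ t : ℝ, 0 ≤ t → ∀ x ∈ Set.Icc (0:ℝ) 1, HasSum (fun j : ℕ => P t j * x ^ j) (Φ t x))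
    (hΦ0 : ∀ x ∈ Set.Icc (0:ℝ) 1, Φ 0 x = x)
    (hKol : ∀ x ∈ Set.Icc (0:ℝ) 1, ∀ t : ℝ, 0 ≤ t → HasDerivAt (fun s => Φ s x) (f (Φ t x)) t)
    (b : ℝ)
    (hcrit : HasSum (fun k : ℕ => (k : ℝ) * a k) 0)
    (hb : HasSum (fun k : ℕ => (k : ℝ) * ((k : ℝ) - 1) * a k) b)
    :
    ∀ r : ℝ, 0 ≤ r → r < 1 →
      (fun t : ℝ => ⨆ x : Set.Icc (0:ℝ) r, |1 - (1 - Φ t (x : ℝ)) / (1 - Φ t 0)|)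
        =O[Filter.atTop] fun t : ℝ => Real.log t / t := by
  have hmem : ∀ t : ℝ, 0 ≤ t → ∀ x ∈ Set.Icc (0:ℝ) 1, Φ t x ∈ Set.Icc (0:ℝ) 1 := by
    intro t ht x hx
    constructor
    · exact (hΦ t ht x hx).nonneg fun j => mul_nonneg (hPnn t ht j) (pow_nonneg hx.1 j)
    · exact hasSum_le (fun j => mul_le_of_le_one_right (hPnn t ht j) (pow_le_one₀ hx.1 hx.2))
        (hΦ t ht x hx) (hPsum t ht)
  have hmono : ∀ t : ℝ, 0 ≤ t → ∀ x ∈ Set.Icc (0:ℝ) 1, ∀ y ∈ Set.Icc (0:ℝ) 1, x ≤ y →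
      Φ t x ≤ Φ t y := by
    intro t ht x hx y hy hxy
    exact hasSum_le (fun j => mul_le_mul_of_nonneg_left (pow_le_pow_left₀ hx.1 hxy j) (hPnn t ht j))
      (hΦ t ht x hx) (hΦ t ht y hy)
  have hsum0 : HasSum a 0 := by
    have h := ha1.add (hasSum_ite_eq (1:ℕ) (a 1))
    rw [neg_add_cancel] at h
    convert h using 2 with k
    by_cases hk : k = 1 <;> simp [hk]
  have hD : ∀ x ∈ Set.Icc (0:ℝ) 1,
      HasSum (fun k : ℕ => a k * (x ^ k - 1 - k * (x - 1))) (f x) := by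
    intro x hx
    have h := ((hf x hx).sub hsum0).sub (hcrit.mul_right (x - 1))
    simp only [zero_mul, sub_zero] at h
    have e : (fun k : ℕ => a k * (x ^ k - 1 - k * (x - 1)))
        = fun k : ℕ => a k * x ^ k - a k - (k:ℝ) * a k * (x - 1) := by
      funext k
      ring
    rw [e]
    exact h
  have hlow : ∀ x ∈ Set.Icc (0:ℝ) 1, a 0 * (1 - x) ^ 2 ≤ f x := by
    intro x hx
    have h := (((hcrit.sub hsum0).add (hasSum_ite_eq (0:ℕ) (a 0))).mul_right ((1 - x) ^ 2))
    simp only [sub_zero, zero_add] at h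
    refine hasSum_le (fun k => ?_) h (hD x hx)
    obtain ⟨i0, i1, i2⟩ := aux_D x hx.1 hx.2 k
    by_cases h0 : k = 0
    · subst h0; simp
    by_cases h1 : k = 1
    · subst h1; simp
    have := mul_le_mul_of_nonneg_left i1 (ha k h1)
    simp only [h0, if_false]
    linarith
  have hup : ∀ x ∈ Set.Icc (0:ℝ) 1, f x ≤ b * (1 - x) ^ 2 := by
    intro x hx
    refine hasSum_le (fun k => ?_) (hD x hx) (hb.mul_right ((1 - x) ^ 2))
    obtain ⟨i0, i1, i2⟩ := aux_D x hx.1 hx.2 k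
    by_cases h1 : k = 1
    · subst h1; simp
    have := mul_le_mul_of_nonneg_left i2 (ha k h1)
    linarith
  have z01 : (0:ℝ) ∈ Set.Icc (0:ℝ) 1 := by simp
  have hbpos : 0 < b := by
    have h1 := hlow 0 z01
    have h2 := hup 0 z01
    norm_num at h1 h2
    linarith
  -- Lipschitz
  have hK := hcrit.summable.abs
  set K : NNReal := ⟨∑' k : ℕ, |(k:ℝ) * a k|, tsum_nonneg fun _ => abs_nonneg _⟩ with hKdef
  have hLip : LipschitzOnWith K f (Set.Icc (0:ℝ) 1) := by
    refine LipschitzOnWith.of_dist_le_mul fun x hx y hy => ?_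
    have hpow : ∀ k : ℕ, |x ^ k - y ^ k| ≤ k * |x - y| := by
      intro k
      induction k with
      | zero => simp
      | succ k ih =>
        have e : x ^ (k+1) - y ^ (k+1) = x * (x ^ k - y ^ k) + y ^ k * (x - y) := by ring
        rw [e]
        refine (abs_add_le _ _).trans ?_
        rw [abs_mul, abs_mul, abs_of_nonneg hx.1, abs_of_nonneg (pow_nonneg hy.1 k)]
        have h1 := mul_le_of_le_one_left (abs_nonneg (x ^ k - y ^ k)) hx.2
        have h2 := mul_le_of_le_one_left (abs_nonneg (x - y)) (pow_le_one₀ (n := k) hy.1 hy.2)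
        push_cast
        linarith
    have hs := (hf x hx).sub (hf y hy)
    have hb1 := hK.hasSum.mul_right |x - y|
    rw [Real.dist_eq, Real.dist_eq]
    have hterm : ∀ k : ℕ, |a k * x ^ k - a k * y ^ k| ≤ |(k:ℝ) * a k| * |x - y| := by
      intro k
      rw [← mul_sub, abs_mul, abs_mul, Nat.abs_cast]
      have := mul_le_mul_of_nonneg_left (hpow k) (abs_nonneg (a k))
      linarith
    change _ ≤ (∑' k : ℕ, |(k:ℝ) * a k|) * |x - y|
    rw [abs_le]
    constructor
    · exact hasSum_le (fun k => (abs_le.1 (hterm k)).1) hb1.neg hs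
    · exact hasSum_le (fun k => (abs_le.1 (hterm k)).2) hs hb1
  have hsemi : ∀ s : ℝ, 0 ≤ s → ∀ t : ℝ, 0 ≤ t → Φ t (Φ s 0) = Φ (t + s) 0 := by
    intro s hs t ht
    have hy := hmem s hs 0 z01
    have hd1 : ∀ u : ℝ, 0 ≤ u → HasDerivAt (fun u => Φ u (Φ s 0)) (f (Φ u (Φ s 0))) u :=
      fun u hu => hKol _ hy u hu
    have hd2 : ∀ u : ℝ, 0 ≤ u → HasDerivAt (fun u => Φ (u + s) 0) (f (Φ (u + s) 0)) u :=
      fun u hu => (hKol 0 z01 (u + s) (by linarith)).comp_add_const u s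
    have := ODE_solution_unique_of_mem_Icc_right (v := fun _ => f) (s := fun _ => Set.Icc (0:ℝ) 1)
      (K := K) (a := 0) (b := t) (f := fun u => Φ u (Φ s 0)) (g := fun u => Φ (u + s) 0)
      (fun _ _ => hLip)
      (fun u hu => (hd1 u hu.1).continuousAt.continuousWithinAt)
      (fun u hu => (hd1 u hu.1).hasDerivWithinAt)
      (fun u hu => hmem u hu.1 _ hy)
      (fun u hu => (hd2 u hu.1).continuousAt.continuousWithinAt)
      (fun u hu => (hd2 u hu.1).hasDerivWithinAt)
      (fun u hu => hmem _ (by linarith [hu.1]) _ z01)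
      (by simp [hΦ0 _ hy])
    exact this ⟨ht, le_refl t⟩
  -- positivity
  have hpos : ∀ t : ℝ, 0 ≤ t → 0 < 1 - Φ t 0 := by
    intro t ht
    have hd : ∀ u : ℝ, 0 ≤ u → HasDerivAt (fun u => (1 - Φ u 0) * Real.exp (b * u))
        (-(f (Φ u 0)) * Real.exp (b * u) + (1 - Φ u 0) * (Real.exp (b * u) * (b * 1))) u :=
      fun u hu => ((hKol 0 z01 u hu).const_sub 1).mul (((hasDerivAt_id u).const_mul b).exp)
    have hm : MonotoneOn (fun u => (1 - Φ u 0) * Real.exp (b * u)) (Set.Ici (0:ℝ)) := by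
      refine monotoneOn_of_deriv_nonneg (convex_Ici 0)
        (fun u hu => (hd u hu).continuousAt.continuousWithinAt) ?_ ?_
      · intro u hu
        rw [interior_Ici] at hu
        exact (hd u hu.le).differentiableAt.differentiableWithinAt
      · intro u hu
        rw [interior_Ici] at hu
        rw [(hd u hu.le).deriv]
        have h1 := hmem u hu.le 0 z01
        have h2 := hup _ h1
        have h3 : (1 - Φ u 0) ^ 2 ≤ 1 - Φ u 0 := by nlinarith [h1.1, h1.2]
        have h4 : 0 ≤ b * (1 - Φ u 0) - f (Φ u 0) := by nlinarith
        have := mul_nonneg h4 (Real.exp_pos (b * u)).le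
        linarith
    have h := hm (Set.mem_Ici.2 le_rfl) (Set.mem_Ici.2 ht) ht
    simp only [hΦ0 0 z01, mul_zero, Real.exp_zero, sub_zero, mul_one] at h
    by_contra hc
    have := mul_nonpos_of_nonpos_of_nonneg (not_lt.1 hc) (Real.exp_pos (b * t)).le
    linarith
  have hdinv : ∀ c u : ℝ, 0 ≤ u → HasDerivAt (fun u => (1 - Φ u 0)⁻¹ - c * u)
      (-(-(f (Φ u 0))) / (1 - Φ u 0) ^ 2 - c * 1) u :=
    fun c u hu => (((hKol 0 z01 u hu).const_sub 1).inv (hpos u hu).ne').sub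
      ((hasDerivAt_id u).const_mul c)
  have hmon1 : MonotoneOn (fun u => (1 - Φ u 0)⁻¹ - a 0 * u) (Set.Ici (0:ℝ)) := by
    refine monotoneOn_of_deriv_nonneg (convex_Ici 0)
      (fun u hu => (hdinv _ u hu).continuousAt.continuousWithinAt) ?_ ?_
    · intro u hu
      rw [interior_Ici] at hu
      exact (hdinv _ u hu.le).differentiableAt.differentiableWithinAt
    · intro u hu
      rw [interior_Ici] at hu
      rw [(hdinv _ u hu.le).deriv, neg_neg, mul_one, sub_nonneg,
        le_div_iff₀ (pow_pos (hpos u hu.le) 2)]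
      exact hlow _ (hmem u hu.le 0 z01)
  have hmon2 : AntitoneOn (fun u => (1 - Φ u 0)⁻¹ - b * u) (Set.Ici (0:ℝ)) := by
    refine antitoneOn_of_deriv_nonpos (convex_Ici 0)
      (fun u hu => (hdinv _ u hu).continuousAt.continuousWithinAt) ?_ ?_
    · intro u hu
      rw [interior_Ici] at hu
      exact (hdinv _ u hu.le).differentiableAt.differentiableWithinAt
    · intro u hu
      rw [interior_Ici] at hu
      rw [(hdinv _ u hu.le).deriv, neg_neg, mul_one, sub_nonpos,
        div_le_iff₀ (pow_pos (hpos u hu.le) 2)]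
      exact hup _ (hmem u hu.le 0 z01)
  have hinv : ∀ t : ℝ, 0 ≤ t → 1 + a 0 * t ≤ (1 - Φ t 0)⁻¹ := by
    intro t ht
    have h := hmon1 (Set.mem_Ici.2 le_rfl) (Set.mem_Ici.2 ht) ht
    simp only [hΦ0 0 z01, mul_zero, sub_zero, inv_one] at h
    linarith
  have hdec : ∀ t : ℝ, 0 ≤ t → (1 - Φ t 0) * (1 + a 0 * t) ≤ 1 := by
    intro t ht
    have h := mul_le_mul_of_nonneg_left (hinv t ht) (hpos t ht).le
    rwa [mul_inv_cancel₀ (hpos t ht).ne'] at h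
  intro r hr0 hr1
  obtain ⟨s, hs, hrs⟩ : ∃ s : ℝ, 0 ≤ s ∧ r ≤ Φ s 0 := by
    have hr : 0 < 1 - r := by linarith
    refine ⟨(1 - r)⁻¹ / a 0, by positivity, ?_⟩
    have hs : 0 ≤ (1 - r)⁻¹ / a 0 := by positivity
    have h := hinv _ hs
    rw [mul_div_cancel₀ _ ha0.ne'] at h
    have h2 : (1 - r)⁻¹ ≤ (1 - Φ ((1 - r)⁻¹ / a 0) 0)⁻¹ := by linarith
    have := (inv_le_inv₀ hr (hpos _ hs)).1 h2
    linarith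
  refine Asymptotics.IsBigO.of_bound (b * s / a 0) ?_
  filter_upwards [Filter.eventually_ge_atTop (Real.exp 1)] with t ht
  have htpos : 0 < t := (Real.exp_pos 1).trans_le ht
  have hlog : 1 ≤ Real.log t := (Real.le_log_iff_exp_le htpos).2 ht
  have : Nonempty (Set.Icc (0:ℝ) r) := ⟨⟨0, le_rfl, hr0⟩⟩
  rw [Real.norm_of_nonneg (Real.iSup_nonneg fun _ => abs_nonneg _),
    Real.norm_of_nonneg (by positivity)]
  have hts : 0 ≤ t + s := by linarith
  have hR := hpos t htpos.le
  have hRs := hpos (t + s) hts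
  refine ciSup_le fun x => ?_
  have hx : (x : ℝ) ∈ Set.Icc (0:ℝ) 1 := ⟨x.2.1, x.2.2.trans hr1.le⟩
  have hys := hmem s hs 0 z01
  have h1 := hmono t htpos.le 0 z01 x hx hx.1
  have h2 := hmono t htpos.le x hx _ hys (x.2.2.trans hrs)
  rw [hsemi s hs t htpos.le] at h2
  have h3 := hmon2 (Set.mem_Ici.2 htpos.le) (Set.mem_Ici.2 hts) (by linarith : t ≤ t + s)
  simp only at h3
  have hle : (1 - Φ t x) / (1 - Φ t 0) ≤ 1 := by
    rw [div_le_one hR]; linarith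
  rw [abs_of_nonneg (by linarith)]
  have h4 : (1 - Φ (t + s) 0) / (1 - Φ t 0) ≤ (1 - Φ t x) / (1 - Φ t 0) := by
    gcongr
  have h5 : 1 - (1 - Φ (t + s) 0) / (1 - Φ t 0)
      = (1 - Φ (t + s) 0) * ((1 - Φ (t + s) 0)⁻¹ - (1 - Φ t 0)⁻¹) := by
    rw [mul_sub, mul_inv_cancel₀ hRs.ne', div_eq_mul_inv]
  have h6 : (1 - Φ (t + s) 0) * ((1 - Φ (t + s) 0)⁻¹ - (1 - Φ t 0)⁻¹)
      ≤ (1 - Φ (t + s) 0) * (b * s) :=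
    mul_le_mul_of_nonneg_left (by linarith) hRs.le
  have h7 : 1 - Φ (t + s) 0 ≤ 1 / (a 0 * t) := by
    rw [le_div_iff₀ (by positivity)]
    have := hdec (t + s) hts
    have h8 := mul_nonneg hRs.le (by positivity : 0 ≤ 1 + a 0 * s)
    linarith
  have h9 : (1 - Φ (t + s) 0) * (b * s) ≤ 1 / (a 0 * t) * (b * s) :=
    mul_le_mul_of_nonneg_right h7 (by positivity)
  have h10 : 1 / (a 0 * t) * (b * s) = b * s / a 0 * (1 / t) := by
    field_simp
  have h11 : b * s / a 0 * (1 / t) ≤ b * s / a 0 * (Real.log t / t) := by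
    gcongr
  linarith
end
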